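/- arXiv:1508.01500 — 2 statements merged into one kernel-verified Lean document; each statement's English description precedes it below -/
import Mathlib

section
/- Let α ∈ ℝ, s > 1/2, σ > 0, and let u ∈ C^∞(ℝ; H^s₊(S¹)) solve the α-Szegő equation i∂ₜu = Π(|u|²u) + α(u|1). For each t let u'_σ(t) and v'_σ(t) denote the orthogonal projections in L²₊ of u(t) and of the constant function 1 onto F_{u(t)}(σ) = ker(K_{u(t)}² − σ² I). Then the quantity ℓ_σ(t) := ‖u'_σ(t)‖² − α‖v'_σ(t)‖² (L² norms) is independent of t. -/
open Complex Filter
open scoped ComplexConjugate Topology ENNReal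

noncomputable section

/-- ℓ²(ℕ, ℂ): the sequence model of the Hardy space L²₊(S¹), identifying a function
with its sequence of nonnegative Fourier coefficients. -/
abbrev Hardy : Type := lp (fun _ : ℕ => ℂ) 2

/-- A coefficient sequence belongs to L²₊. -/
def MemL2 (u : ℕ → ℂ) : Prop := Memℓp u 2

/-- A coefficient sequence belongs to the Sobolev space H^s₊. -/
def MemHs (s : ℝ) (u : ℕ → ℂ) : Prop :=
  Summable fun n : ℕ => ((1 : ℝ) + (n : ℝ) ^ 2) ^ s * ‖u n‖ ^ 2

/-- The squared H^s norm of a coefficient sequence. -/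
def hsNormSq (s : ℝ) (u : ℕ → ℂ) : ℝ :=
  ∑' n : ℕ, ((1 : ℝ) + (n : ℝ) ^ 2) ^ s * ‖u n‖ ^ 2

/-- The L² inner product (f|g), ℂ-linear in the first argument. -/
def hinner (f g : ℕ → ℂ) : ℂ := ∑' n : ℕ, f n * conj (g n)

/-- The squared L² norm. -/
def l2normSq (f : ℕ → ℂ) : ℝ := ∑' n : ℕ, ‖f n‖ ^ 2

/-- Coefficients of the constant function 1. -/
def oneSeq : ℕ → ℂ := fun n => if n = 0 then 1 else 0

/-- The Hankel operator H_u(h) = Π(u ⬝ conj h) in Fourier coefficients. -/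
def hankel (u h : ℕ → ℂ) : ℕ → ℂ := fun k => ∑' ℓ : ℕ, u (k + ℓ) * conj (h ℓ)

/-- The shifted Hankel operator K_u = T_z^* ∘ H_u in Fourier coefficients. -/
def khankel (u h : ℕ → ℂ) : ℕ → ℂ := fun k => ∑' ℓ : ℕ, u (k + 1 + ℓ) * conj (h ℓ)

/-- H_u². -/
def hu2 (u h : ℕ → ℂ) : ℕ → ℂ := hankel u (hankel u h)

/-- K_u². -/
def ku2 (u h : ℕ → ℂ) : ℕ → ℂ := khankel u (khankel u h)

/-- The m-th Fourier coefficient of |u|², m ∈ ℤ. -/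
def absSqCoeff (u : ℕ → ℂ) (m : ℤ) : ℂ :=
  ∑' q : ℕ × ℕ, if ((q.1 : ℤ) - (q.2 : ℤ) = m) then u q.1 * conj (u q.2) else 0

/-- The Toeplitz operator T_{|u|²} in Fourier coefficients. -/
def toeplitzAbsSq (u h : ℕ → ℂ) : ℕ → ℂ :=
  fun k => ∑' ℓ : ℕ, absSqCoeff u ((k : ℤ) - (ℓ : ℤ)) * h ℓ

/-- Fourier coefficients of Π(|u|²u). -/
def cubic (u : ℕ → ℂ) : ℕ → ℂ := fun n =>
  ∑' q : ℕ × ℕ × ℕ, if q.1 + q.2.2 = q.2.1 + n then u q.1 * conj (u q.2.1) * u q.2.2 else 0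

/-- `u : ℝ → (ℕ → ℂ)` solves the α-Szegő equation i ∂ₜ u = Π(|u|²u) + α(u|1),
written coefficientwise on nonnegative Fourier modes. -/
def SolvesSzego (α : ℝ) (u : ℝ → ℕ → ℂ) : Prop :=
  ∀ n t, HasDerivAt (fun τ => u τ n)
    (-Complex.I * (cubic (u t) n + (α : ℂ) * u t 0 * oneSeq n)) t

/-- `u` is a smooth curve valued in H^s₊. -/
def SmoothHsCurve (s : ℝ) (u : ℝ → ℕ → ℂ) : Prop :=
  (∀ t, MemHs s (u t)) ∧ ∀ n, ContDiff ℝ (⊤ : ℕ∞) fun t => u t n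

/-- `u` is a continuous curve valued in H^s₊. -/
def ContHsCurve (s : ℝ) (u : ℝ → ℕ → ℂ) : Prop :=
  (∀ t, MemHs s (u t)) ∧
    ∀ t₀ : ℝ, Tendsto (fun t => hsNormSq s (fun n => u t n - u t₀ n)) (𝓝 t₀) (𝓝 0)

/-- E_u(τ) = ker(H_u² − τ² I) as a subset of ℓ². -/
def Espace (u : ℕ → ℂ) (τ : ℝ) : Set (ℕ → ℂ) :=
  {h | MemL2 h ∧ hu2 u h = ((τ : ℂ) ^ 2) • h}

/-- F_u(τ) = ker(K_u² − τ² I) as a subset of ℓ². -/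
def Fspace (u : ℕ → ℂ) (τ : ℝ) : Set (ℕ → ℂ) :=
  {h | MemL2 h ∧ ku2 u h = ((τ : ℂ) ^ 2) • h}

/-- Σ_H(u): τ > 0 such that E_u(τ) is not orthogonal to u. -/
def SigmaH (u : ℕ → ℂ) : Set ℝ :=
  {τ : ℝ | 0 < τ ∧ ∃ v ∈ Espace u τ, hinner u v ≠ 0}

/-- Σ_K(u): τ ≥ 0 such that F_u(τ) is not orthogonal to u. -/
def SigmaK (u : ℕ → ℂ) : Set ℝ :=
  {τ : ℝ | 0 ≤ τ ∧ ∃ v ∈ Fspace u τ, hinner u v ≠ 0}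

/-- `p` is the orthogonal projection of `w` on the subspace `V` of ℓ². -/
def IsOrthProj (V : Set (ℕ → ℂ)) (w p : ℕ → ℂ) : Prop :=
  p ∈ V ∧ ∀ v ∈ V, hinner (w - p) v = 0

/-- The rank of the shifted Hankel operator K_u. -/
def kuRank (u : ℕ → ℂ) : Cardinal :=
  Module.rank ℂ (Submodule.span ℂ (khankel u '' {h | MemL2 h}))

/-- The rank of the Hankel operator H_u. -/
def huRank (u : ℕ → ℂ) : Cardinal :=
  Module.rank ℂ (Submodule.span ℂ (hankel u '' {h | MemL2 h}))

/-- ℒ(N) : rank K_u = N. -/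
def InLN (N : ℕ) (u : ℕ → ℂ) : Prop := MemL2 u ∧ kuRank u = N

/-- The constant function 1 as an element of ℓ². -/
def oneH : Hardy := lp.single 2 0 1

/-- The weight `(1 + n) ^ r`. -/
def wt (r : ℝ) (n : ℕ) : ℝ≥0∞ := ((n : ℝ≥0∞) + 1) ^ r

/-- The cubic form `∑_{a + c = b + n} x a * x b * x c` on nonnegative sequences. -/
def cubicMajorant (x : ℕ → ℝ≥0∞) (n : ℕ) : ℝ≥0∞ :=
  ∑' q : ℕ × ℕ × ℕ, if q.1 + q.2.2 = q.2.1 + n then x q.1 * x q.2.1 * x q.2.2 else 0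

lemma enorm_cubic_le (u : ℕ → ℂ) (n : ℕ) :
    ‖cubic u n‖ₑ ≤ cubicMajorant (fun n => ‖u n‖ₑ) n := by
  refine enorm_tsum_le_tsum_enorm.trans (ENNReal.tsum_le_tsum fun q => ?_)
  split_ifs
  · simp [enorm_mul]
  · simp

lemma tsum_diag_le (f : ℕ → ℝ≥0∞) (b c : ℕ) :
    ∑' n, ∑' a, (if a + c = b + n then f n else 0) ≤ ∑' n, f n := by
  refine ENNReal.tsum_le_tsum fun n => ?_
  rw [tsum_eq_single (b + n - c)]
  · split_ifs <;> simp
  · intro a ha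
    rw [if_neg]
    omega

lemma mul_le_sq_add_sq (y z : ℝ≥0∞) : y * z ≤ y ^ 2 + z ^ 2 := by
  rcases le_total y z with h | h
  · calc y * z ≤ z * z := by gcongr
      _ ≤ y ^ 2 + z ^ 2 := by rw [sq z]; exact le_add_self
  · calc y * z ≤ y * y := by gcongr
      _ ≤ y ^ 2 + z ^ 2 := by rw [sq y]; exact le_self_add

lemma tsum_diag_mul_le (y : ℕ → ℝ≥0∞) (b c : ℕ) :
    ∑' n, ∑' a, (if a + c = b + n then y n * y a else 0) ≤ 2 * ∑' n, y n ^ 2 := by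
  calc ∑' n, ∑' a, (if a + c = b + n then y n * y a else 0)
      ≤ ∑' n, ∑' a, ((if a + c = b + n then y n ^ 2 else 0) +
          (if a + c = b + n then y a ^ 2 else 0)) := by
        refine ENNReal.tsum_le_tsum fun n => ENNReal.tsum_le_tsum fun a => ?_
        split_ifs
        · exact mul_le_sq_add_sq _ _
        · simp
    _ = (∑' n, ∑' a, (if a + c = b + n then y n ^ 2 else 0)) +
          ∑' n, ∑' a, (if a + c = b + n then y a ^ 2 else 0) := by
        simp_rw [ENNReal.tsum_add]
    _ ≤ (∑' n, y n ^ 2) + ∑' n, y n ^ 2 := by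
        refine add_le_add ?_ ?_
        · exact tsum_diag_le (fun n => y n ^ 2) b c
        · rw [ENNReal.tsum_comm]
          refine le_trans (le_of_eq ?_) (tsum_diag_le (fun n => y n ^ 2) c b)
          exact tsum_congr fun n => tsum_congr fun a => if_congr (by omega) rfl rfl
    _ = 2 * ∑' n, y n ^ 2 := by ring

lemma tsum_quad_mul_le (x y : ℕ → ℝ≥0∞) :
    ∑' n, ∑' q : ℕ × ℕ × ℕ,
      (if q.1 + q.2.2 = q.2.1 + n then y n * (y q.1 * x q.2.1 * x q.2.2) else 0)
      ≤ 2 * (∑' n, x n) ^ 2 * ∑' n, y n ^ 2 := by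
  calc ∑' n, ∑' q : ℕ × ℕ × ℕ,
        (if q.1 + q.2.2 = q.2.1 + n then y n * (y q.1 * x q.2.1 * x q.2.2) else 0)
      = ∑' q : ℕ × ℕ, x q.1 * x q.2 *
          ∑' n, ∑' a, (if a + q.2 = q.1 + n then y n * y a else 0) := by
        have hswap : ∀ n : ℕ, ∑' q : ℕ × ℕ × ℕ,
            (if q.1 + q.2.2 = q.2.1 + n then y n * (y q.1 * x q.2.1 * x q.2.2) else 0) =
            ∑' q : ℕ × ℕ, ∑' a,
              (if a + q.2 = q.1 + n then y n * (y a * x q.1 * x q.2) else 0) := fun n => by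
          rw [ENNReal.tsum_prod', ENNReal.tsum_comm]
        simp_rw [hswap, ← ENNReal.tsum_mul_left]
        rw [ENNReal.tsum_comm]
        refine tsum_congr fun q => tsum_congr fun n => tsum_congr fun a => ?_
        simp only [mul_ite, mul_zero]
        congr 1
        ring
    _ ≤ ∑' q : ℕ × ℕ, x q.1 * x q.2 * (2 * ∑' n, y n ^ 2) := by
        gcongr
        exact tsum_diag_mul_le y _ _
    _ = 2 * (∑' n, x n) ^ 2 * ∑' n, y n ^ 2 := by
        rw [ENNReal.tsum_mul_right, ENNReal.tsum_prod']
        simp only [ENNReal.tsum_mul_left, ENNReal.tsum_mul_right]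
        ring

lemma wt_add (r r' : ℝ) (n : ℕ) : wt (r + r') n = wt r n * wt r' n := by
  unfold wt
  exact ENNReal.rpow_add _ _ (by positivity) (by simp)

lemma wt_le_add {r : ℝ} (hr : 0 ≤ r) {n a c : ℕ} (h : n ≤ a + c) :
    wt r n ≤ 2 ^ r * (wt r a + wt r c) := by
  have key : ∀ a c : ℕ, a ≤ c → n ≤ a + c → wt r n ≤ 2 ^ r * (wt r a + wt r c) := by
    intro a c hac h
    have h1 : (n : ℝ≥0∞) + 1 ≤ 2 * (c + 1) := by
      have : n + 1 ≤ 2 * (c + 1) := by omega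
      exact_mod_cast this
    calc wt r n ≤ (2 * (c + 1)) ^ r := ENNReal.rpow_le_rpow h1 hr
      _ = 2 ^ r * wt r c := ENNReal.mul_rpow_of_nonneg _ _ hr
      _ ≤ _ := by gcongr; exact le_add_self
  rcases le_total a c with hac | hac
  · exact key a c hac h
  · rw [add_comm (wt r a)]
    exact key c a hac (by omega)

lemma one_le_wt {r : ℝ} (hr : 0 ≤ r) (n : ℕ) : 1 ≤ wt r n := by
  unfold wt
  calc (1 : ℝ≥0∞) = 1 ^ r := by simp
    _ ≤ _ := ENNReal.rpow_le_rpow le_add_self hr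

lemma wt_ne_top (r : ℝ) (n : ℕ) : wt r n ≠ ∞ := by
  unfold wt
  exact ENNReal.rpow_ne_top_of_ne_zero (by positivity) (by finiteness)

lemma wt_ne_zero (r : ℝ) (n : ℕ) : wt r n ≠ 0 := by
  unfold wt
  exact (ENNReal.rpow_pos (by positivity) (by finiteness)).ne'

lemma wt_sq (r : ℝ) (n : ℕ) : wt r n ^ 2 = wt (2 * r) n := by
  rw [two_mul, wt_add, sq]

/-- Weighted energy `∑ (1 + n) ^ (2 r) * x n ^ 2`. -/
def energy (r : ℝ) (x : ℕ → ℝ≥0∞) : ℝ≥0∞ := ∑' n, wt (2 * r) n * x n ^ 2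

/-- Weighted Wiener norm `∑ (1 + n) ^ r * x n`. -/
def wiener (r : ℝ) (x : ℕ → ℝ≥0∞) : ℝ≥0∞ := ∑' n, wt r n * x n

lemma tsum_le_wiener {r : ℝ} (hr : 0 ≤ r) (x : ℕ → ℝ≥0∞) : ∑' n, x n ≤ wiener r x :=
  ENNReal.tsum_le_tsum fun n => le_mul_of_one_le_left' (one_le_wt hr n)

lemma tsum_wt_cubicMajorant_le {r : ℝ} (hr : 0 ≤ r) (x : ℕ → ℝ≥0∞) :
    ∑' n, wt (2 * r) n * x n * cubicMajorant x n
      ≤ 4 * 2 ^ r * (∑' n, x n) ^ 2 * energy r x := by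
  set y : ℕ → ℝ≥0∞ := fun n => wt r n * x n with hy
  have hE : energy r x = ∑' n, y n ^ 2 := by
    refine tsum_congr fun n => ?_
    rw [hy, mul_pow, wt_sq]
  set Q : ℝ≥0∞ := ∑' n, ∑' q : ℕ × ℕ × ℕ,
      (if q.1 + q.2.2 = q.2.1 + n then y n * (y q.1 * x q.2.1 * x q.2.2) else 0) with hQ
  set Q' : ℝ≥0∞ := ∑' n, ∑' q : ℕ × ℕ × ℕ,
      (if q.1 + q.2.2 = q.2.1 + n then y n * (x q.1 * x q.2.1 * y q.2.2) else 0) with hQ'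
  have hQQ : Q' = Q := by
    refine tsum_congr fun n => ?_
    let e : ℕ × ℕ × ℕ ≃ ℕ × ℕ × ℕ :=
      ⟨fun q => (q.2.2, q.2.1, q.1), fun q => (q.2.2, q.2.1, q.1), fun _ => rfl, fun _ => rfl⟩
    rw [← e.tsum_eq]
    refine tsum_congr fun q => ?_
    simp only [e, Equiv.coe_fn_mk, add_comm q.2.2]
    congr 1
    ring
  calc ∑' n, wt (2 * r) n * x n * cubicMajorant x n
      ≤ ∑' n, ∑' q : ℕ × ℕ × ℕ, 2 ^ r * (
        (if q.1 + q.2.2 = q.2.1 + n then y n * (y q.1 * x q.2.1 * x q.2.2) else 0) +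
        (if q.1 + q.2.2 = q.2.1 + n then y n * (x q.1 * x q.2.1 * y q.2.2) else 0)) := by
        refine ENNReal.tsum_le_tsum fun n => ?_
        rw [cubicMajorant, ← ENNReal.tsum_mul_left]
        refine ENNReal.tsum_le_tsum fun q => ?_
        split_ifs with h
        · rw [← wt_sq, sq]
          calc wt r n * wt r n * x n * (x q.1 * x q.2.1 * x q.2.2)
              = wt r n * (wt r n * x n * (x q.1 * x q.2.1 * x q.2.2)) := by ring
            _ ≤ (2 ^ r * (wt r q.1 + wt r q.2.2)) *
                  (wt r n * x n * (x q.1 * x q.2.1 * x q.2.2)) := by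
                gcongr
                exact wt_le_add hr (by omega)
            _ = _ := by simp only [hy]; ring
        · simp
    _ = 2 ^ r * (Q + Q') := by
        simp_rw [ENNReal.tsum_mul_left, ENNReal.tsum_add]
        rfl
    _ ≤ 2 ^ r * (2 * (∑' n, x n) ^ 2 * energy r x + 2 * (∑' n, x n) ^ 2 * energy r x) := by
        rw [hQQ, hE]
        gcongr <;> exact tsum_quad_mul_le x y
    _ = _ := by ring

lemma wt_le_mul {r : ℝ} (hr : 0 ≤ r) {n a c : ℕ} (h : n ≤ a + c) :
    wt r n ≤ wt r a * wt r c := by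
  unfold wt
  rw [← ENNReal.mul_rpow_of_nonneg _ _ hr]
  refine ENNReal.rpow_le_rpow ?_ hr
  have : n + 1 ≤ (a + 1) * (c + 1) := by nlinarith
  exact_mod_cast this

lemma tsum_quad_ite_le (f : ℕ × ℕ × ℕ → ℝ≥0∞) :
    ∑' n, ∑' q : ℕ × ℕ × ℕ, (if q.1 + q.2.2 = q.2.1 + n then f q else 0) ≤ ∑' q, f q := by
  rw [ENNReal.tsum_comm]
  refine ENNReal.tsum_le_tsum fun q => ?_
  rw [tsum_eq_single (q.1 + q.2.2 - q.2.1)]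
  · split_ifs <;> simp
  · intro n hn
    rw [if_neg]
    omega

lemma tsum_triple (f g h : ℕ → ℝ≥0∞) :
    ∑' q : ℕ × ℕ × ℕ, f q.1 * g q.2.1 * h q.2.2 = (∑' n, f n) * (∑' n, g n) * ∑' n, h n := by
  rw [ENNReal.tsum_prod']
  simp_rw [ENNReal.tsum_prod', ENNReal.tsum_mul_left, ENNReal.tsum_mul_right,
    ENNReal.tsum_mul_left, ENNReal.tsum_mul_right]

lemma wiener_cubicMajorant_le {r : ℝ} (hr : 0 ≤ r) (x : ℕ → ℝ≥0∞) :
    wiener r (cubicMajorant x) ≤ wiener r x ^ 3 := by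
  set y : ℕ → ℝ≥0∞ := fun n => wt r n * x n with hy
  calc wiener r (cubicMajorant x)
      ≤ ∑' n, ∑' q : ℕ × ℕ × ℕ,
          (if q.1 + q.2.2 = q.2.1 + n then y q.1 * y q.2.1 * y q.2.2 else 0) := by
        refine ENNReal.tsum_le_tsum fun n => ?_
        rw [cubicMajorant, ← ENNReal.tsum_mul_left]
        refine ENNReal.tsum_le_tsum fun q => ?_
        split_ifs with h
        · calc wt r n * (x q.1 * x q.2.1 * x q.2.2)
              ≤ wt r q.1 * wt r q.2.2 * (x q.1 * (wt r q.2.1 * x q.2.1) * x q.2.2) := by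
                gcongr
                · exact wt_le_mul hr (by omega)
                · exact le_mul_of_one_le_left' (one_le_wt hr _)
            _ = _ := by simp only [hy]; ring
        · simp
    _ ≤ ∑' q : ℕ × ℕ × ℕ, y q.1 * y q.2.1 * y q.2.2 := tsum_quad_ite_le _
    _ = _ := by
        rw [tsum_triple]
        simp only [hy, wiener]
        ring

lemma wt_eq_ofReal (r : ℝ) (n : ℕ) : wt r n = ENNReal.ofReal (((n : ℝ) + 1) ^ r) := by
  unfold wt
  rw [← ENNReal.ofReal_rpow_of_pos (by positivity), ENNReal.ofReal_add (by positivity) (by simp)]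
  simp

lemma tsum_wt_ne_top {r : ℝ} (hr : r < -1) : ∑' n, wt r n ≠ ∞ := by
  simp_rw [wt_eq_ofReal]
  refine Summable.tsum_ofReal_ne_top ?_
  have := (summable_nat_add_iff 1).2 (Real.summable_nat_rpow.2 hr)
  simpa using this

lemma wiener_le_add_energy (ε s : ℝ) (x : ℕ → ℝ≥0∞) :
    wiener ε x ≤ (∑' n, wt (2 * (ε - s)) n) + energy s x := by
  rw [wiener, energy, ← ENNReal.tsum_add]
  refine ENNReal.tsum_le_tsum fun n => ?_
  have h := mul_le_sq_add_sq (wt (ε - s) n) (wt s n * x n)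
  rwa [mul_pow, wt_sq, wt_sq, ← mul_assoc, ← wt_add, sub_add_cancel] at h

lemma wt_mono_right {r r' : ℝ} (h : r ≤ r') (n : ℕ) : wt r n ≤ wt r' n := by
  unfold wt
  exact ENNReal.rpow_le_rpow_of_exponent_le le_add_self h

lemma wt_mono_left {r : ℝ} (hr : 0 ≤ r) {n m : ℕ} (h : n ≤ m) : wt r n ≤ wt r m := by
  unfold wt
  refine ENNReal.rpow_le_rpow ?_ hr
  gcongr

lemma energy_mono {r r' : ℝ} (h : r ≤ r') (x : ℕ → ℝ≥0∞) : energy r x ≤ energy r' x := by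
  unfold energy
  gcongr with n
  exact wt_mono_right (by linarith) n

lemma sq_sum_range_le (x : ℕ → NNReal) (K : ℕ) :
    (∑ n ∈ Finset.range K, (x n : ℝ≥0∞)) ^ 2 ≤
      ENNReal.ofReal (1 + Real.log K) * energy (1 / 2) (fun n => x n) := by
  have h1 : (∑ n ∈ Finset.range K, x n) ^ 2 ≤
      (∑ n ∈ Finset.range K, ((n : NNReal) + 1)⁻¹) *
        ∑ n ∈ Finset.range K, ((n : NNReal) + 1) * x n ^ 2 := by
    refine Finset.sum_sq_le_sum_mul_sum_of_sq_le_mul _ (by simp) (by simp) fun n _ => ?_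
    rw [← mul_assoc, inv_mul_cancel₀ (by positivity), one_mul]
  have h2 : (((∑ n ∈ Finset.range K, ((n : NNReal) + 1)⁻¹ : NNReal)) : ℝ≥0∞) ≤
      ENNReal.ofReal (1 + Real.log K) := by
    have h3 : ((∑ n ∈ Finset.range K, ((n : NNReal) + 1)⁻¹ : NNReal) : ℝ) ≤ 1 + Real.log K := by
      have := harmonic_le_one_add_log K
      simpa [harmonic] using this
    calc (((∑ n ∈ Finset.range K, ((n : NNReal) + 1)⁻¹ : NNReal)) : ℝ≥0∞)
        = ENNReal.ofReal ((∑ n ∈ Finset.range K, ((n : NNReal) + 1)⁻¹ : NNReal) : ℝ) := by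
          rw [ENNReal.ofReal_coe_nnreal]
      _ ≤ _ := ENNReal.ofReal_le_ofReal h3
  calc (∑ n ∈ Finset.range K, (x n : ℝ≥0∞)) ^ 2
      = (((∑ n ∈ Finset.range K, x n) ^ 2 : NNReal) : ℝ≥0∞) := by push_cast; rfl
    _ ≤ (((∑ n ∈ Finset.range K, ((n : NNReal) + 1)⁻¹) *
        ∑ n ∈ Finset.range K, ((n : NNReal) + 1) * x n ^ 2 : NNReal) : ℝ≥0∞) := by
        exact_mod_cast h1
    _ ≤ _ := by
        rw [ENNReal.coe_mul]
        gcongr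
        refine le_trans (le_of_eq ?_) (ENNReal.sum_le_tsum (Finset.range K))
        push_cast
        refine Finset.sum_congr rfl fun n _ => ?_
        simp [wt]

lemma tail_le {r : ℝ} (hr : 0 ≤ r) (x : ℕ → ℝ≥0∞) (K : ℕ) :
    wt r K * ∑' n, x (n + K) ≤ wiener r x := by
  rw [← ENNReal.tsum_mul_left]
  calc ∑' n, wt r K * x (n + K) ≤ ∑' n, wt r (n + K) * x (n + K) := by
        gcongr with n
        exact wt_mono_left hr (by omega)
    _ ≤ _ := ENNReal.tsum_comp_le_tsum_of_injective (add_left_injective K)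
          (fun n => wt r n * x n)

lemma sum_range_add_tail (x : ℕ → ℝ≥0∞) (K : ℕ) :
    ∑' n, x n = ∑ n ∈ Finset.range K, x n + ∑' n, x (n + K) :=
  (ENNReal.summable.sum_add_tsum_nat_add' ).symm

/-- Brezis–Gallouet type inequality: the `ℓ¹` norm is controlled by the `H^{1/2}` norm up to a
logarithm of the `H^s` norm. -/
lemma sq_tsum_le_log {s : ℝ} (hs : 1 / 2 < s) : ∃ C : ℝ, 0 ≤ C ∧ ∀ (x : ℕ → NNReal) (B : ℝ),
    0 ≤ B → energy s (fun n => x n) ≤ ENNReal.ofReal B →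
    (∑' n, (x n : ℝ≥0∞)) ^ 2 ≤
      ENNReal.ofReal (C * (1 + Real.log (1 + B))) * (1 + energy (1 / 2) (fun n => x n)) := by
  set ε := (s - 1 / 2) / 2 with hε
  have hε0 : 0 < ε := by rw [hε]; linarith
  have hfin : ∑' n, wt (2 * (ε - s)) n ≠ ∞ := tsum_wt_ne_top (by rw [hε]; linarith)
  set C₁ := (∑' n, wt (2 * (ε - s)) n).toReal with hC₁
  have hC₁0 : 0 ≤ C₁ := ENNReal.toReal_nonneg
  refine ⟨3 * (2 + 1 / ε) + 3 * (C₁ + 1) ^ 2, by positivity, fun x B hB hE => ?_⟩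
  set K := ⌈(1 + B) ^ (1 / ε)⌉₊ with hK
  have hpow : 1 ≤ (1 + B) ^ (1 / ε) := Real.one_le_rpow (by linarith) (by positivity)
  have hK0 : 0 < K := Nat.ceil_pos.2 (by linarith)
  have hL0 : 0 ≤ Real.log (1 + B) := Real.log_nonneg (by linarith)
  have hlogK : Real.log K ≤ 1 + 1 / ε * Real.log (1 + B) := by
    have hKle : (K : ℝ) ≤ 2 * (1 + B) ^ (1 / ε) := by
      have := Nat.ceil_lt_add_one (a := (1 + B) ^ (1 / ε)) (by positivity)
      linarith
    calc Real.log K ≤ Real.log (2 * (1 + B) ^ (1 / ε)) :=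
          Real.log_le_log (by exact_mod_cast hK0) hKle
      _ = Real.log 2 + 1 / ε * Real.log (1 + B) := by
          rw [Real.log_mul (by norm_num) (by positivity), Real.log_rpow (by linarith)]
      _ ≤ _ := by
          have := Real.log_two_lt_d9
          linarith
  have htail : ∑' n, (x (n + K) : ℝ≥0∞) ≤ ENNReal.ofReal (C₁ + 1) := by
    have h1 : ENNReal.ofReal (1 + B) ≤ wt ε K := by
      rw [wt_eq_ofReal]
      refine ENNReal.ofReal_le_ofReal ?_
      calc 1 + B = ((1 + B) ^ (1 / ε)) ^ ε := by
            rw [← Real.rpow_mul (by linarith), one_div_mul_cancel hε0.ne', Real.rpow_one]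
        _ ≤ ((K : ℝ) + 1) ^ ε := by
            refine Real.rpow_le_rpow (by positivity) ?_ hε0.le
            have := Nat.le_ceil ((1 + B) ^ (1 / ε))
            linarith
    have h2 : ENNReal.ofReal (1 + B) * ∑' n, (x (n + K) : ℝ≥0∞) ≤
        ENNReal.ofReal (1 + B) * ENNReal.ofReal (C₁ + 1) := by
      calc ENNReal.ofReal (1 + B) * ∑' n, (x (n + K) : ℝ≥0∞)
          ≤ wt ε K * ∑' n, (x (n + K) : ℝ≥0∞) := by gcongr
        _ ≤ wiener ε (fun n => x n) := tail_le hε0.le (fun n => (x n : ℝ≥0∞)) K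
        _ ≤ (∑' n, wt (2 * (ε - s)) n) + energy s (fun n => x n) := wiener_le_add_energy _ _ _
        _ ≤ ENNReal.ofReal C₁ + ENNReal.ofReal B := by
            gcongr
            rw [hC₁, ENNReal.ofReal_toReal hfin]
        _ = ENNReal.ofReal (C₁ + B) := (ENNReal.ofReal_add hC₁0 hB).symm
        _ ≤ ENNReal.ofReal ((1 + B) * (C₁ + 1)) := ENNReal.ofReal_le_ofReal (by nlinarith)
        _ = _ := ENNReal.ofReal_mul (by linarith)
    exact (ENNReal.mul_le_mul_iff_right (by simp; linarith) (by simp)).1 h2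
  set P := energy (1 / 2) (fun n => (x n : ℝ≥0∞)) with hP
  have hhead := sq_sum_range_le x K
  set a := ∑ n ∈ Finset.range K, (x n : ℝ≥0∞)
  set b := ∑' n, (x (n + K) : ℝ≥0∞)
  have hsplit : ∑' n, (x n : ℝ≥0∞) = a + b := sum_range_add_tail _ K
  rw [hsplit]
  calc (a + b) ^ 2 = a ^ 2 + 2 * (a * b) + b ^ 2 := by ring
    _ ≤ a ^ 2 + 2 * (a ^ 2 + b ^ 2) + b ^ 2 := by gcongr; exact mul_le_sq_add_sq a b
    _ = 3 * a ^ 2 + 3 * b ^ 2 := by ring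
    _ ≤ 3 * (ENNReal.ofReal (1 + Real.log K) * P) + 3 * ENNReal.ofReal (C₁ + 1) ^ 2 := by gcongr
    _ ≤ 3 * (ENNReal.ofReal ((2 + 1 / ε) * (1 + Real.log (1 + B))) * (1 + P)) +
          3 * (ENNReal.ofReal ((C₁ + 1) ^ 2 * (1 + Real.log (1 + B))) * (1 + P)) := by
        gcongr ?_ + ?_
        · gcongr
          · have : 0 ≤ 1 / ε := by positivity
            nlinarith
          · exact le_add_self
        · gcongr
          rw [← ENNReal.ofReal_pow (by positivity)]
          refine le_mul_of_le_of_one_le ?_ le_self_add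
          refine ENNReal.ofReal_le_ofReal ?_
          nlinarith [sq_nonneg (C₁ + 1)]
    _ = _ := by
        rw [← mul_assoc, ← mul_assoc, ← add_mul]
        congr 1
        rw [show (3 : ℝ≥0∞) = ENNReal.ofReal 3 by simp, ← ENNReal.ofReal_mul (by norm_num),
          ← ENNReal.ofReal_mul (by norm_num), ← ENNReal.ofReal_add (by positivity) (by positivity)]
        congr 1
        ring

lemma hasDerivAt_norm_sq_coeff {α : ℝ} {u : ℝ → ℕ → ℂ} (hsol : SolvesSzego α u) (n : ℕ) (t : ℝ) :
    HasDerivAt (fun τ => ‖u τ n‖ ^ 2) (2 * (conj (u t n) * cubic (u t) n).im) t := by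
  have h := (hsol n t).norm_sq
  convert h using 2
  rw [Complex.inner]
  rcases eq_or_ne n 0 with rfl | hn
  · simp [oneSeq]
    ring
  · simp [oneSeq, hn]
    ring

/-- The moduli of the coefficients, as extended nonnegative reals. -/
def amp (u : ℕ → ℂ) (n : ℕ) : ℝ≥0∞ := (‖u n‖₊ : ℝ≥0∞)

lemma enorm_cubic_le_amp (u : ℕ → ℂ) (n : ℕ) : ‖cubic u n‖ₑ ≤ cubicMajorant (amp u) n :=
  enorm_cubic_le u n

lemma ofReal_norm_le_of_enorm_le {z : ℂ} {r : ℝ} (hr : 0 ≤ r) (h : ‖z‖ₑ ≤ ENNReal.ofReal r) :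
    ‖z‖ ≤ r := by
  rwa [← ofReal_norm, ENNReal.ofReal_le_ofReal_iff hr] at h

lemma wt_sum_eq_ofReal (r : ℝ) (u : ℕ → ℂ) (K : ℕ) :
    ∑ n ∈ Finset.range K, wt (2 * r) n * amp u n ^ 2 =
      ENNReal.ofReal (∑ n ∈ Finset.range K, ((n : ℝ) + 1) ^ (2 * r) * ‖u n‖ ^ 2) := by
  rw [ENNReal.ofReal_sum_of_nonneg (fun n _ => by positivity)]
  refine Finset.sum_congr rfl fun n _ => ?_
  rw [ENNReal.ofReal_mul (by positivity), wt_eq_ofReal, ENNReal.ofReal_pow (by positivity),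
    ofReal_norm]
  rfl

lemma abs_partial_energy_sub_le {α : ℝ} {u : ℝ → ℕ → ℂ} (hsol : SolvesSzego α u) (r : ℝ) (K : ℕ)
    {t t' C : ℝ}
    (hC : ∀ τ ∈ Set.uIcc t' t,
      |∑ n ∈ Finset.range K, ((n : ℝ) + 1) ^ (2 * r) * (conj (u τ n) * cubic (u τ) n).im| ≤ C) :
    |(∑ n ∈ Finset.range K, ((n : ℝ) + 1) ^ (2 * r) * ‖u t n‖ ^ 2) -
      ∑ n ∈ Finset.range K, ((n : ℝ) + 1) ^ (2 * r) * ‖u t' n‖ ^ 2| ≤ 2 * C * |t - t'| := by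
  have hd : ∀ τ, HasDerivAt
      (fun τ => ∑ n ∈ Finset.range K, ((n : ℝ) + 1) ^ (2 * r) * ‖u τ n‖ ^ 2)
      (2 * ∑ n ∈ Finset.range K, ((n : ℝ) + 1) ^ (2 * r) * (conj (u τ n) * cubic (u τ) n).im)
      τ := fun τ => by
    rw [Finset.mul_sum]
    refine HasDerivAt.fun_sum fun n _ => ?_
    exact ((hasDerivAt_norm_sq_coeff hsol n τ).const_mul (((n : ℝ) + 1) ^ (2 * r))).congr_deriv
      (by ring)
  have := (convex_uIcc t' t).norm_image_sub_le_of_norm_hasDerivWithin_le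
    (fun τ _ => (hd τ).hasDerivWithinAt) (C := 2 * C) (fun τ hτ => ?_)
    Set.left_mem_uIcc Set.right_mem_uIcc
  · simpa [Real.norm_eq_abs] using this
  · rw [Real.norm_eq_abs, abs_mul, abs_two]
    exact mul_le_mul_of_nonneg_left (hC τ hτ) (by norm_num)

lemma enorm_flux_term_le (r : ℝ) (u : ℕ → ℂ) (n : ℕ) :
    ‖((((n : ℝ) + 1) ^ (2 * r) : ℝ) : ℂ) * (conj (u n) * cubic u n)‖ₑ ≤
      wt (2 * r) n * amp u n * cubicMajorant (amp u) n := by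
  rw [enorm_mul, enorm_mul, mul_assoc]
  gcongr
  · rw [wt_eq_ofReal, ← ofReal_norm, Complex.norm_real, Real.norm_of_nonneg (by positivity)]
  · simp [amp, ← ofReal_norm]
  · exact enorm_cubic_le_amp u n

lemma energy_le_add {α : ℝ} {u : ℝ → ℕ → ℂ} (hsol : SolvesSzego α u) {r C t t' : ℝ} (hC0 : 0 ≤ C)
    (hC : ∀ τ ∈ Set.uIcc t' t,
      ∑' n, wt (2 * r) n * amp (u τ) n * cubicMajorant (amp (u τ)) n ≤ ENNReal.ofReal C) :
    energy r (amp (u t)) ≤ energy r (amp (u t')) + ENNReal.ofReal (2 * C * |t - t'|) := by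
  rw [energy, ENNReal.tsum_eq_iSup_nat]
  refine iSup_le fun K => ?_
  have hK := abs_partial_energy_sub_le hsol r K (C := C) (t := t) (t' := t') fun τ hτ => by
    have h1 : ‖∑ n ∈ Finset.range K,
        ((((n : ℝ) + 1) ^ (2 * r) : ℝ) : ℂ) * (conj (u τ n) * cubic (u τ) n)‖ ≤ C := by
      refine ofReal_norm_le_of_enorm_le hC0 ((enorm_sum_le _ _).trans ?_)
      refine (Finset.sum_le_sum fun n _ => enorm_flux_term_le r (u τ) n).trans ?_
      exact (ENNReal.sum_le_tsum _).trans (hC τ hτ)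
    refine le_trans ?_ h1
    refine le_trans (le_of_eq ?_) (Complex.abs_im_le_norm _)
    simp only [Complex.im_sum, Complex.im_ofReal_mul]
  calc ∑ n ∈ Finset.range K, wt (2 * r) n * amp (u t) n ^ 2
      ≤ ENNReal.ofReal ((∑ n ∈ Finset.range K, ((n : ℝ) + 1) ^ (2 * r) * ‖u t' n‖ ^ 2) +
          2 * C * |t - t'|) := by
        rw [wt_sum_eq_ofReal]
        exact ENNReal.ofReal_le_ofReal (by linarith [(abs_le.1 hK).2])
    _ = ∑ n ∈ Finset.range K, wt (2 * r) n * amp (u t') n ^ 2 +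
          ENNReal.ofReal (2 * C * |t - t'|) := by
        rw [ENNReal.ofReal_add (by positivity) (by positivity), wt_sum_eq_ofReal]
    _ ≤ _ := by
        gcongr
        exact ENNReal.sum_le_tsum _

lemma tsum_flux_le {s : ℝ} (hs : 1 / 2 < s) (u : ℕ → ℂ) :
    ∑' n, wt (2 * s) n * amp u n * cubicMajorant (amp u) n ≤
      4 * 2 ^ s * (∑' n, amp u n) ^ 2 * energy s (amp u) :=
  tsum_wt_cubicMajorant_le (by linarith) _

/-- The summands of the momentum flux, with the weight attached to the frequency `w p`. -/
def momentumFlux (u : ℕ → ℂ) (w : ℕ × ℕ × ℕ × ℕ → ℕ) (p : ℕ × ℕ × ℕ × ℕ) : ℂ :=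
  if p.2.1 + p.2.2.2 = p.2.2.1 + p.1 then
    (((w p : ℝ) + 1 : ℝ) : ℂ) * (conj (u p.1) * (u p.2.1 * conj (u p.2.2.1) * u p.2.2.2)) else 0

lemma enorm_momentumFlux_le (u : ℕ → ℂ) (p : ℕ × ℕ × ℕ × ℕ) :
    ‖momentumFlux u Prod.fst p‖ₑ ≤
      (wt 1 p.1 * amp u p.1) * (if p.2.1 + p.2.2.2 = p.2.2.1 + p.1 then
        amp u p.2.1 * amp u p.2.2.1 * amp u p.2.2.2 else 0) := by
  rw [momentumFlux]
  split_ifs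
  · rw [enorm_mul, enorm_mul, mul_assoc (wt 1 p.1)]
    refine mul_le_mul' ?_ (mul_le_mul' ?_ ?_)
    · rw [wt_eq_ofReal, ← ofReal_norm, Complex.norm_real, Real.norm_of_nonneg (by positivity),
        Real.rpow_one]
    · simp [amp, ← ofReal_norm]
    · simp [amp, enorm_eq_nnnorm]
  · simp

lemma summable_momentumFlux {u : ℕ → ℂ}
    (hfin : ∑' n, wt 1 n * amp u n * cubicMajorant (amp u) n ≠ ∞) :
    Summable (momentumFlux u Prod.fst) := by
  refine Summable.of_enorm (ne_top_of_le_ne_top hfin ?_)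
  refine (ENNReal.tsum_le_tsum (enorm_momentumFlux_le u)).trans (le_of_eq ?_)
  rw [ENNReal.tsum_prod']
  refine tsum_congr fun n => ?_
  simp only [ENNReal.tsum_mul_left, cubicMajorant]

lemma tsum_flux_eq_tsum_momentumFlux {u : ℕ → ℂ} (hsum : Summable (momentumFlux u Prod.fst)) :
    ∑' n : ℕ, (((n : ℝ) + 1 : ℝ) : ℂ) * (conj (u n) * cubic u n) =
      ∑' p, momentumFlux u Prod.fst p := by
  rw [hsum.tsum_prod]
  refine tsum_congr fun n => ?_
  rw [cubic, ← tsum_mul_left, ← tsum_mul_left]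
  refine tsum_congr fun q => ?_
  simp only [momentumFlux]
  split_ifs <;> simp

/-- Exchange of the two outer frequencies of a quadruple. -/
def swapConj : ℕ × ℕ × ℕ × ℕ ≃ ℕ × ℕ × ℕ × ℕ :=
  ⟨fun p => (p.2.2.1, p.2.1, p.1, p.2.2.2), fun p => (p.2.2.1, p.2.1, p.1, p.2.2.2),
    fun _ => rfl, fun _ => rfl⟩

/-- Exchange of incoming and outgoing frequencies of a quadruple. -/
def swapInOut : ℕ × ℕ × ℕ × ℕ ≃ ℕ × ℕ × ℕ × ℕ :=
  ⟨fun p => (p.2.1, p.1, p.2.2.2, p.2.2.1), fun p => (p.2.1, p.1, p.2.2.2, p.2.2.1),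
    fun _ => rfl, fun _ => rfl⟩

lemma momentumFlux_swapConj (u : ℕ → ℂ) (p : ℕ × ℕ × ℕ × ℕ) :
    momentumFlux u Prod.fst (swapConj p) = momentumFlux u (fun p => p.2.2.1) p := by
  simp only [momentumFlux, swapConj, Equiv.coe_fn_mk]
  refine if_congr (by omega) ?_ rfl
  ring

lemma conj_momentumFlux_swapInOut (u : ℕ → ℂ) (p : ℕ × ℕ × ℕ × ℕ) :
    conj (momentumFlux u Prod.fst (swapInOut p) +
        momentumFlux u Prod.fst (swapConj (swapInOut p))) =
      momentumFlux u Prod.fst p + momentumFlux u Prod.fst (swapConj p) := by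
  rw [momentumFlux_swapConj, momentumFlux_swapConj, map_add]
  by_cases h : p.2.1 + p.2.2.2 = p.2.2.1 + p.1
  · have h' : (swapInOut p).2.1 + (swapInOut p).2.2.2 = (swapInOut p).2.2.1 + (swapInOut p).1 := by
      change p.1 + p.2.2.1 = p.2.2.2 + p.2.1
      omega
    have hC : (p.2.1 : ℂ) + p.2.2.2 = p.2.2.1 + p.1 := by exact_mod_cast h
    simp only [momentumFlux]
    rw [if_pos h', if_pos h', if_pos h, if_pos h]
    simp only [swapInOut, Equiv.coe_fn_mk, map_mul, Complex.conj_conj, Complex.conj_ofReal]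
    push_cast
    linear_combination
      (u p.2.1 * conj (u p.1) * conj (u p.2.2.1) * u p.2.2.2) * hC
  · have h' : ¬ (swapInOut p).2.1 + (swapInOut p).2.2.2 =
        (swapInOut p).2.2.1 + (swapInOut p).1 := by
      change ¬ p.1 + p.2.2.1 = p.2.2.2 + p.2.1
      omega
    simp only [momentumFlux]
    rw [if_neg h', if_neg h', if_neg h, if_neg h]
    simp

/-- The total flux of the momentum vanishes. -/
lemma im_tsum_flux_eq_zero (u : ℕ → ℂ)
    (hfin : ∑' n, wt 1 n * amp u n * cubicMajorant (amp u) n ≠ ∞) :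
    (∑' n : ℕ, (((n : ℝ) + 1 : ℝ) : ℂ) * (conj (u n) * cubic u n)).im = 0 := by
  have hsum := summable_momentumFlux hfin
  rw [tsum_flux_eq_tsum_momentumFlux hsum]
  have hse : Summable fun p => momentumFlux u Prod.fst (swapConj p) :=
    hsum.comp_injective swapConj.injective
  have h1 : ∑' p, (momentumFlux u Prod.fst p + momentumFlux u Prod.fst (swapConj p)) =
      ∑' p, momentumFlux u Prod.fst p + ∑' p, momentumFlux u Prod.fst p := by
    rw [hsum.tsum_add hse, swapConj.tsum_eq (momentumFlux u Prod.fst)]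
  have h3 := swapInOut.tsum_eq
    (fun p => momentumFlux u Prod.fst p + momentumFlux u Prod.fst (swapConj p))
  have h2 : conj (∑' p, (momentumFlux u Prod.fst p + momentumFlux u Prod.fst (swapConj p))) =
      ∑' p, (momentumFlux u Prod.fst p + momentumFlux u Prod.fst (swapConj p)) := by
    conv_lhs => rw [← h3, Complex.conj_tsum]
    exact tsum_congr (conj_momentumFlux_swapInOut u)
  rw [h1] at h2
  have h4 := Complex.conj_eq_iff_im.1 h2
  rw [Complex.add_im] at h4
  linarith

lemma tsum_amp_le_add_energy (s : ℝ) (u : ℕ → ℂ) :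
    ∑' n, amp u n ≤ (∑' n, wt (2 * (0 - s)) n) + energy s (amp u) :=
  (tsum_le_wiener le_rfl _).trans (wiener_le_add_energy 0 s _)

lemma exists_tsum_flux_le {s : ℝ} (hs : 1 / 2 < s) {B : ℝ≥0∞} (hB : B ≠ ∞) :
    ∃ D : ℝ, 0 ≤ D ∧ ∀ u : ℕ → ℂ, energy s (amp u) ≤ B →
      ∑' n, wt (2 * s) n * amp u n * cubicMajorant (amp u) n ≤ ENNReal.ofReal D := by
  have hW : ∑' n, wt (2 * (0 - s)) n ≠ ∞ := tsum_wt_ne_top (by linarith)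
  have hD : 4 * 2 ^ s * ((∑' n, wt (2 * (0 - s)) n) + B) ^ 2 * B ≠ ∞ := by
    refine ENNReal.mul_ne_top (ENNReal.mul_ne_top (ENNReal.mul_ne_top (by simp) ?_) ?_) hB
    · exact ENNReal.rpow_ne_top_of_nonneg (by linarith) (by simp)
    · exact ENNReal.pow_ne_top (ENNReal.add_ne_top.2 ⟨hW, hB⟩)
  refine ⟨(4 * 2 ^ s * ((∑' n, wt (2 * (0 - s)) n) + B) ^ 2 * B).toReal, ENNReal.toReal_nonneg,
    fun u hu => ?_⟩
  rw [ENNReal.ofReal_toReal hD]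
  refine (tsum_flux_le hs u).trans ?_
  gcongr
  exact (tsum_amp_le_add_energy s u).trans (by gcongr)

lemma tsum_tail_flux_le {s : ℝ} (hs : 1 / 2 < s) {D : ℝ} (u : ℕ → ℂ)
    (hD : ∑' n, wt (2 * s) n * amp u n * cubicMajorant (amp u) n ≤ ENNReal.ofReal D) (K : ℕ) :
    ∑' n, wt 1 (n + K) * amp u (n + K) * cubicMajorant (amp u) (n + K) ≤
      ENNReal.ofReal (((K : ℝ) + 1) ^ (1 - 2 * s) * D) := by
  have h := tail_le (r := 2 * s - 1) (by linarith)
    (fun n => wt 1 n * amp u n * cubicMajorant (amp u) n) K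
  have h2 : wiener (2 * s - 1) (fun n => wt 1 n * amp u n * cubicMajorant (amp u) n) =
      ∑' n, wt (2 * s) n * amp u n * cubicMajorant (amp u) n := by
    refine tsum_congr fun n => ?_
    rw [show 2 * s = (2 * s - 1) + 1 by ring, wt_add]
    ring_nf
  rw [h2] at h
  rw [ENNReal.ofReal_mul (by positivity), ← wt_eq_ofReal]
  calc _ = wt (1 - 2 * s) K * (wt (2 * s - 1) K *
        ∑' n, wt 1 (n + K) * amp u (n + K) * cubicMajorant (amp u) (n + K)) := by
        rw [← mul_assoc, ← wt_add]
        simp [wt]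
    _ ≤ _ := by
        gcongr
        exact h.trans hD

lemma abs_partial_flux_le {s : ℝ} (hs : 1 / 2 < s) {D : ℝ} (hD0 : 0 ≤ D) (u : ℕ → ℂ)
    (hD : ∑' n, wt (2 * s) n * amp u n * cubicMajorant (amp u) n ≤ ENNReal.ofReal D) (K : ℕ) :
    |∑ n ∈ Finset.range K, ((n : ℝ) + 1) ^ (2 * (1 / 2 : ℝ)) * (conj (u n) * cubic u n).im| ≤
      ((K : ℝ) + 1) ^ (1 - 2 * s) * D := by
  set f : ℕ → ℂ := fun n => (((n : ℝ) + 1 : ℝ) : ℂ) * (conj (u n) * cubic u n) with hf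
  have hfe : ∀ n, ‖f n‖ₑ ≤ wt 1 n * amp u n * cubicMajorant (amp u) n := fun n => by
    simpa [hf] using enorm_flux_term_le (1 / 2) u n
  have hfin : ∑' n, wt 1 n * amp u n * cubicMajorant (amp u) n ≠ ∞ := by
    have := tsum_tail_flux_le hs u hD 0
    exact ne_top_of_le_ne_top ENNReal.ofReal_ne_top this
  have hsum : Summable f :=
    Summable.of_enorm (ne_top_of_le_ne_top hfin (ENNReal.tsum_le_tsum hfe))
  have h0 : (∑' n, f n).im = 0 := im_tsum_flux_eq_zero u hfin
  rw [← hsum.sum_add_tsum_nat_add K, Complex.add_im] at h0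
  have h1 : (∑ n ∈ Finset.range K, f n).im =
      ∑ n ∈ Finset.range K, ((n : ℝ) + 1) ^ (2 * (1 / 2 : ℝ)) * (conj (u n) * cubic u n).im := by
    rw [Complex.im_sum]
    refine Finset.sum_congr rfl fun n _ => ?_
    rw [hf, Complex.im_ofReal_mul]
    norm_num
  rw [← h1, eq_neg_of_add_eq_zero_left h0, abs_neg]
  refine (Complex.abs_im_le_norm _).trans (ofReal_norm_le_of_enorm_le (by positivity) ?_)
  refine (enorm_tsum_le_tsum_enorm).trans
    ((ENNReal.tsum_le_tsum fun n => hfe _).trans (tsum_tail_flux_le hs u hD K))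

lemma energy_half_le {α : ℝ} {u : ℝ → ℕ → ℂ} (hsol : SolvesSzego α u) {s : ℝ} (hs : 1 / 2 < s)
    {t t' : ℝ} {B : ℝ≥0∞} (hB : B ≠ ∞) (hN : ∀ τ ∈ Set.uIcc t' t, energy s (amp (u τ)) ≤ B) :
    energy (1 / 2) (amp (u t)) ≤ energy (1 / 2) (amp (u t')) := by
  obtain ⟨D, hD0, hD⟩ := exists_tsum_flux_le hs hB
  have hlim : Tendsto (fun K : ℕ => ENNReal.ofReal
      (2 * (((K : ℝ) + 1) ^ (1 - 2 * s) * D) * |t - t'|)) atTop (𝓝 0) := by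
    rw [← ENNReal.ofReal_zero]
    refine ENNReal.tendsto_ofReal ?_
    have h1 : Tendsto (fun K : ℕ => ((K : ℝ) + 1) ^ (1 - 2 * s)) atTop (𝓝 0) := by
      have := (tendsto_rpow_neg_atTop (y := 2 * s - 1) (by linarith)).comp
        (tendsto_atTop_add_const_right _ (1 : ℝ) tendsto_natCast_atTop_atTop (α := ℕ))
      simpa [Function.comp_def] using this
    simpa using ((h1.mul_const D).const_mul 2).mul_const |t - t'|
  have hT : ∀ τ, Tendsto (fun K => ∑ n ∈ Finset.range K, wt (2 * (1 / 2)) n * amp (u τ) n ^ 2) atTop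
      (𝓝 (energy (1 / 2) (amp (u τ)))) := fun τ => ENNReal.tendsto_nat_tsum _
  have := le_of_tendsto_of_tendsto' (hT t) ((hT t').add hlim) fun K => by
    have hK := abs_partial_energy_sub_le hsol (1 / 2) K (t := t) (t' := t') fun τ hτ =>
      abs_partial_flux_le hs hD0 (u τ) (hD _ (hN τ hτ)) K
    rw [wt_sum_eq_ofReal, wt_sum_eq_ofReal, ← ENNReal.ofReal_add (by positivity) (by positivity)]
    exact ENNReal.ofReal_le_ofReal (by linarith [(abs_le.1 hK).2])
  simpa using this

/-- Chaining of short-step estimates along an interval. -/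
lemma le_iterate_of_short_steps {f : ℝ → ℝ} {a b h : ℝ} {F : ℝ → ℝ}
    (hstep : ∀ t ∈ Set.uIcc a b, ∀ t' ∈ Set.uIcc a b, ∀ M, |t - t'| ≤ h → f t' ≤ M → f t ≤ F M)
    (m : ℕ) {t t' M : ℝ} (ht : t ∈ Set.uIcc a b) (ht' : t' ∈ Set.uIcc a b)
    (hm : |t - t'| ≤ m * h) (hM : f t' ≤ M) : f t ≤ F^[m] M := by
  induction m generalizing t' M with
  | zero =>
    have : t = t' := by
      have : |t - t'| ≤ 0 := by simpa using hm
      linarith [abs_eq_zero.1 (le_antisymm this (abs_nonneg _))]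
    simpa [this] using hM
  | succ m ih =>
    rw [Function.iterate_succ_apply]
    set c : ℝ := 1 / ((m : ℝ) + 1) with hc
    have hm0 : (0 : ℝ) < m + 1 := by positivity
    have hc0 : 0 ≤ c := by positivity
    have hc1 : c ≤ 1 := by
      rw [hc, div_le_one hm0]
      linarith [(Nat.cast_nonneg m : (0 : ℝ) ≤ m)]
    have hmem : (1 - c) • t' + c • t ∈ Set.uIcc a b :=
      (convex_uIcc a b) ht' ht (by linarith) hc0 (by ring)
    have hcm : c * (m + 1) = 1 := by
      rw [hc]
      field_simp
    push_cast at hm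
    have hh : 0 ≤ h := by
      have := (abs_nonneg (t - t')).trans hm
      exact nonneg_of_mul_nonneg_right this hm0
    refine ih hmem ?_ (hstep _ hmem _ ht' M ?_ hM)
    · have : t - ((1 - c) • t' + c • t) = (1 - c) * (t - t') := by
        simp only [smul_eq_mul]
        ring
      rw [this, abs_mul, abs_of_nonneg (by linarith)]
      calc (1 - c) * |t - t'| ≤ (1 - c) * ((m + 1) * h) :=
            mul_le_mul_of_nonneg_left hm (by linarith)
        _ = (m + 1 - c * (m + 1)) * h := by ring
        _ = m * h := by
            rw [hcm]
            ring
    · have : (1 - c) • t' + c • t - t' = c * (t - t') := by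
        simp only [smul_eq_mul]
        ring
      rw [this, abs_mul, abs_of_nonneg hc0]
      calc c * |t - t'| ≤ c * ((m + 1) * h) := mul_le_mul_of_nonneg_left hm hc0
        _ = (c * (m + 1)) * h := by ring
        _ = h := by rw [hcm, one_mul]

/-- A differential inequality of the form `|f'| ≤ c (1 + sup f)` bounds the growth of `f`. -/
lemma le_iterate_of_log_growth {f : ℝ → ℝ} {a b c B : ℝ} (hc : 0 < c)
    (hB : ∀ t ∈ Set.uIcc a b, f t ≤ B)
    (hstep : ∀ t ∈ Set.uIcc a b, ∀ t' ∈ Set.uIcc a b, ∀ L, 0 ≤ L → (∀ τ ∈ Set.uIcc t' t, f τ ≤ L) →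
      4 * c * (1 + L) * |t - t'| ≤ 1 → f t ≤ f t' + 1) (h0 : ∀ t, 0 ≤ f t)
    (m : ℕ) {t t' M : ℝ} (ht : t ∈ Set.uIcc a b) (ht' : t' ∈ Set.uIcc a b)
    (hm : |t - t'| ≤ m * (1 / (8 * c))) (hM : f t' ≤ M) :
    f t ≤ (fun x => 2 * x + 3)^[m] M := by
  refine le_iterate_of_short_steps (h := 1 / (8 * c)) ?_ m ht ht' hm hM
  clear ht ht' hm hM
  intro t ht t' ht' M htt hM
  have hsub : ∀ {x y}, x ∈ Set.uIcc a b → y ∈ Set.uIcc a b → Set.uIcc x y ⊆ Set.uIcc a b :=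
    fun hx hy => Set.uIcc_subset_uIcc hx hy
  set L := sSup (f '' Set.uIcc t' t) with hL
  have hbdd : BddAbove (f '' Set.uIcc t' t) := ⟨B, by
    rintro _ ⟨τ, hτ, rfl⟩
    exact hB τ (hsub ht' ht hτ)⟩
  have hfL : ∀ τ ∈ Set.uIcc t' t, f τ ≤ L := fun τ hτ => le_csSup hbdd ⟨τ, hτ, rfl⟩
  have hL0 : 0 ≤ L := (h0 t).trans (hfL t Set.right_mem_uIcc)
  have key : ∀ τ ∈ Set.uIcc t' t, f τ ≤ f t' + ((1 + L) / 2 + 1) := fun τ hτ => by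
    have hτ' : |τ - t'| ≤ 1 / (8 * c) :=
      (Set.abs_sub_left_of_mem_uIcc hτ).trans htt
    set h : ℝ := 1 / (4 * c * (1 + L)) with hh
    have hhpos : 0 < h := by positivity
    set k := ⌈|τ - t'| / h⌉₊ with hk
    have h1 : |τ - t'| ≤ k * h := by
      rw [← div_le_iff₀ hhpos]
      exact Nat.le_ceil _
    have h2 : (k : ℝ) ≤ (1 + L) / 2 + 1 := by
      refine (Nat.ceil_lt_add_one (by positivity)).le.trans ?_
      refine add_le_add ?_ le_rfl
      rw [div_le_iff₀ hhpos, hh]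
      refine hτ'.trans (le_of_eq ?_)
      field_simp
      norm_num
    have := le_iterate_of_short_steps (f := f) (a := t') (b := t) (h := h) (F := fun x => x + 1)
      (fun x hx y hy M hxy hyM => by
        have h3 := hstep x (hsub ht' ht hx) y (hsub ht' ht hy) L hL0
          (fun τ hτ => hfL τ (Set.uIcc_subset_uIcc hy hx hτ)) (by
            rw [hh, le_div_iff₀ (by positivity)] at hxy
            linarith)
        linarith) k hτ Set.left_mem_uIcc h1 le_rfl
    have h4 : ∀ (k : ℕ) (x : ℝ), (fun x : ℝ => x + 1)^[k] x = x + k := fun k x => by simp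
    rw [h4] at this
    linarith
  have hL2 : L ≤ f t' + ((1 + L) / 2 + 1) := by
    refine csSup_le ⟨_, t, Set.right_mem_uIcc, rfl⟩ ?_
    rintro _ ⟨τ, hτ, rfl⟩
    exact key τ hτ
  have := hfL t Set.right_mem_uIcc
  linarith

/-- A priori estimate: along a curve with bounded energy, the energy is controlled on unit time
intervals by its value at one point. -/
lemma exists_energy_growth {α : ℝ} {u : ℝ → ℕ → ℂ} (hsol : SolvesSzego α u) {s : ℝ}
    (hs : 1 / 2 < s) : ∃ G : ℝ → ℝ, ∀ (M t t' : ℝ) (B : ℝ≥0∞), |t - t'| ≤ 1 → B ≠ ∞ →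
      (∀ τ ∈ Set.uIcc t' t, energy s (amp (u τ)) ≤ B) →
      energy s (amp (u t')) ≤ ENNReal.ofReal M → energy s (amp (u t)) ≤ ENNReal.ofReal (G M) := by
  obtain ⟨C, hC0, hC⟩ := sq_tsum_le_log hs
  set c : ℝ → ℝ := fun M => 4 * 2 ^ s * (C + 1) * (1 + max M 0) with hcdef
  refine ⟨fun M => Real.exp ((fun x => 2 * x + 3)^[⌈8 * c M⌉₊] (Real.log (1 + max M 0))),
    fun M t t' B htt hB hN hM => ?_⟩
  have hc : 0 < c M := by positivity
  set f : ℝ → ℝ := fun τ => Real.log (1 + (energy s (amp (u τ))).toReal) with hf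
  have hfin : ∀ τ ∈ Set.uIcc t' t, energy s (amp (u τ)) ≠ ∞ := fun τ hτ =>
    ne_top_of_le_ne_top hB (hN τ hτ)
  have hP : ∀ τ ∈ Set.uIcc t' t, energy (1 / 2) (amp (u τ)) ≤ ENNReal.ofReal (max M 0) :=
    fun τ hτ => by
      refine (energy_half_le hsol hs hB fun x hx => hN x ?_).trans
        ((energy_mono hs.le _).trans (hM.trans (ENNReal.ofReal_le_ofReal (le_max_left _ _))))
      exact Set.uIcc_subset_uIcc_left hτ hx
  have hflog : ∀ {τ L}, τ ∈ Set.uIcc t' t → f τ ≤ L →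
      energy s (amp (u τ)) ≤ ENNReal.ofReal (Real.exp L - 1) := fun {τ L} hτ hL => by
    rw [← ENNReal.ofReal_toReal (hfin τ hτ)]
    refine ENNReal.ofReal_le_ofReal ?_
    have := (Real.log_le_iff_le_exp (by positivity)).1 hL
    linarith
  have hfB : ∀ τ ∈ Set.uIcc t' t, f τ ≤ Real.log (1 + B.toReal) := fun τ hτ => by
    refine Real.log_le_log (by positivity) ?_
    gcongr
    exact hN τ hτ
  have hstep : ∀ x ∈ Set.uIcc t' t, ∀ y ∈ Set.uIcc t' t, ∀ L, 0 ≤ L →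
      (∀ τ ∈ Set.uIcc y x, f τ ≤ L) → 4 * c M * (1 + L) * |x - y| ≤ 1 → f x ≤ f y + 1 := by
    intro x hx y hy L hL hfL hxy
    have hsub : Set.uIcc y x ⊆ Set.uIcc t' t := Set.uIcc_subset_uIcc hy hx
    set S := ⨆ τ ∈ Set.uIcc y x, energy s (amp (u τ)) with hS
    have hSfin : S ≠ ∞ := ne_top_of_le_ne_top hB (iSup₂_le fun τ hτ => hN τ (hsub hτ))
    have hle : ∀ τ ∈ Set.uIcc y x, energy s (amp (u τ)) ≤ S := fun τ hτ =>
      le_iSup₂ (f := fun τ _ => energy s (amp (u τ))) τ hτ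
    have hflux : ∀ τ ∈ Set.uIcc y x,
        ∑' n, wt (2 * s) n * amp (u τ) n * cubicMajorant (amp (u τ)) n ≤
          ENNReal.ofReal (c M * (1 + L) * S.toReal) := fun τ hτ => by
      have h1 := hC (fun n => ‖u τ n‖₊) (Real.exp L - 1) (by linarith [Real.add_one_le_exp L])
        (hflog (hsub hτ) (hfL τ hτ))
      rw [add_sub_cancel, Real.log_exp] at h1
      refine (tsum_flux_le hs (u τ)).trans ?_
      rw [ENNReal.ofReal_mul (by positivity), ENNReal.ofReal_toReal hSfin]
      refine mul_le_mul' ?_ (hle τ hτ)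
      have h2 : (∑' n, amp (u τ) n) ^ 2 ≤
          ENNReal.ofReal (C * (1 + L)) * ENNReal.ofReal (1 + max M 0) := by
        refine h1.trans (mul_le_mul' le_rfl ?_)
        rw [ENNReal.ofReal_add zero_le_one (by positivity), ENNReal.ofReal_one]
        exact add_le_add le_rfl (hP τ (hsub hτ))
      have h3 : (4 * 2 ^ s : ℝ≥0∞) = ENNReal.ofReal (4 * 2 ^ s) := by
        rw [ENNReal.ofReal_mul (by norm_num), ← ENNReal.ofReal_rpow_of_pos (by norm_num)]
        simp
      rw [h3]
      refine (mul_le_mul' le_rfl h2).trans ?_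
      rw [← ENNReal.ofReal_mul (by positivity), ← ENNReal.ofReal_mul (by positivity)]
      refine ENNReal.ofReal_le_ofReal ?_
      rw [hcdef]
      have : 0 ≤ (4 * 2 ^ s : ℝ) * (1 + L) * (1 + max M 0) := by positivity
      simp only
      nlinarith
    have hSle : S ≤ energy s (amp (u y)) + ENNReal.ofReal (S.toReal / 2) := by
      refine iSup₂_le fun τ hτ => ?_
      refine (energy_le_add hsol (C := c M * (1 + L) * S.toReal) (by positivity)
        fun z hz => hflux z (Set.uIcc_subset_uIcc_left hτ hz)).trans ?_
      gcongr
      have hτx : |τ - y| ≤ |x - y| := Set.abs_sub_left_of_mem_uIcc hτ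
      have h5 : 4 * c M * (1 + L) * |τ - y| ≤ 1 :=
        (mul_le_mul_of_nonneg_left hτx (by positivity)).trans hxy
      have h6 := mul_le_mul_of_nonneg_right h5 (ENNReal.toReal_nonneg (a := S))
      linarith
    have hSr : S.toReal ≤ (energy s (amp (u y))).toReal + S.toReal / 2 := by
      have := ENNReal.toReal_mono (ENNReal.add_ne_top.2 ⟨hfin y hy, ENNReal.ofReal_ne_top⟩) hSle
      rwa [ENNReal.toReal_add (hfin y hy) ENNReal.ofReal_ne_top,
        ENNReal.toReal_ofReal (by positivity)] at this
    have hxS : (energy s (amp (u x))).toReal ≤ S.toReal :=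
      ENNReal.toReal_mono hSfin (hle x Set.right_mem_uIcc)
    have hy0 : 0 ≤ (energy s (amp (u y))).toReal := ENNReal.toReal_nonneg
    calc f x ≤ Real.log (2 * (1 + (energy s (amp (u y))).toReal)) :=
          Real.log_le_log (by positivity) (by linarith)
      _ = Real.log 2 + f y := Real.log_mul (by norm_num) (by positivity)
      _ ≤ f y + 1 := by linarith [Real.log_two_lt_d9]
  have hfin' := le_iterate_of_log_growth (f := f) hc hfB hstep
    (fun τ => Real.log_nonneg (by linarith [(energy s (amp (u τ))).toReal_nonneg]))
    ⌈8 * c M⌉₊ Set.right_mem_uIcc Set.left_mem_uIcc (by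
      refine htt.trans ?_
      rw [mul_one_div, le_div_iff₀ (by positivity), one_mul]
      exact Nat.le_ceil _) (M := Real.log (1 + max M 0)) (by
      refine Real.log_le_log (by positivity) ?_
      gcongr
      refine ENNReal.toReal_le_of_le_ofReal (le_max_right _ _) (hM.trans ?_)
      exact ENNReal.ofReal_le_ofReal (le_max_left _ _))
  exact (hflog Set.right_mem_uIcc hfin').trans (ENNReal.ofReal_le_ofReal (by linarith))

lemma IsCompact.exists_bound_of_locally_bounded {N : ℝ → ℝ≥0∞} {K : Set ℝ} (hK : IsCompact K)
    (h : ∀ t ∈ K, ∃ M : ℝ≥0∞, M ≠ ∞ ∧ ∀ᶠ τ in 𝓝 t, N τ ≤ M) :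
    ∃ M : ℝ≥0∞, M ≠ ∞ ∧ ∀ τ ∈ K, N τ ≤ M := by
  refine hK.induction_on (p := fun S => ∃ M : ℝ≥0∞, M ≠ ∞ ∧ ∀ τ ∈ S, N τ ≤ M) ?_ ?_ ?_ ?_
  · exact ⟨0, by simp, by simp⟩
  · rintro S T hST ⟨M, hM, h⟩
    exact ⟨M, hM, fun τ hτ => h τ (hST hτ)⟩
  · rintro S T ⟨M, hM, h⟩ ⟨M', hM', h'⟩
    refine ⟨max M M', by simp [hM, hM'], ?_⟩
    rintro τ (hτ | hτ)
    · exact (h τ hτ).trans (le_max_left _ _)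
    · exact (h' τ hτ).trans (le_max_right _ _)
  · intro t ht
    obtain ⟨M, hM, h⟩ := h t ht
    exact ⟨_, mem_nhdsWithin_of_mem_nhds h, M, hM, fun τ hτ => hτ⟩

/-- A finite lower semicontinuous function satisfying an a priori growth estimate is locally
bounded. -/
lemma locally_bounded_of_growth {N : ℝ → ℝ≥0∞} (hN : LowerSemicontinuous N)
    (hfin : ∀ t, N t ≠ ∞) {G : ℝ → ℝ}
    (hG : ∀ (M t t' : ℝ) (B : ℝ≥0∞), |t - t'| ≤ 1 → B ≠ ∞ → (∀ τ ∈ Set.uIcc t' t, N τ ≤ B) →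
      N t' ≤ ENNReal.ofReal M → N t ≤ ENNReal.ofReal (G M)) (t₀ : ℝ) :
    ∃ M : ℝ≥0∞, M ≠ ∞ ∧ ∀ᶠ τ in 𝓝 t₀, N τ ≤ M := by
  by_contra hcon
  set U : Set ℝ := {t | ∃ M : ℝ≥0∞, M ≠ ∞ ∧ ∀ᶠ τ in 𝓝 t, N τ ≤ M} with hU
  have hUo : IsOpen U := by
    rw [isOpen_iff_mem_nhds]
    rintro t ⟨M, hM, h⟩
    filter_upwards [eventually_eventually_nhds.2 h] with τ hτ
    exact ⟨M, hM, hτ⟩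
  have hCc : IsClosed Uᶜ := hUo.isClosed_compl
  have hne : Nonempty (Uᶜ : Set ℝ) := ⟨⟨t₀, hcon⟩⟩
  have hcomplete : CompleteSpace (Uᶜ : Set ℝ) := hCc.completeSpace_coe
  obtain ⟨k, hk⟩ := nonempty_interior_of_iUnion_of_closed
    (f := fun k : ℕ => {t : (Uᶜ : Set ℝ) | N t ≤ k})
    (fun k => (hN.isClosed_preimage k).preimage continuous_subtype_val) (by
      refine Set.eq_univ_of_forall fun t => Set.mem_iUnion.2 ?_
      obtain ⟨k, hk⟩ := ENNReal.exists_nat_gt (hfin t)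
      exact ⟨k, hk.le⟩)
  obtain ⟨⟨x, hxC⟩, hx⟩ := hk
  rw [mem_interior_iff_mem_nhds, Metric.mem_nhds_iff] at hx
  obtain ⟨r, hr, hball⟩ := hx
  have hNC : ∀ y ∈ Uᶜ, |y - x| < r → N y ≤ k := fun y hy hyx =>
    hball (show (⟨y, hy⟩ : (Uᶜ : Set ℝ)) ∈ Metric.ball _ r from hyx)
  refine hxC ⟨max k (ENNReal.ofReal (G k)), by simp, ?_⟩
  filter_upwards [Metric.ball_mem_nhds x (lt_min hr one_pos)] with t ht
  rw [Metric.mem_ball, Real.dist_eq, lt_min_iff] at ht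
  by_cases htC : t ∈ Uᶜ
  · exact (hNC t htC ht.1).trans (le_max_left _ _)
  refine le_trans ?_ (le_max_right _ _)
  obtain ⟨a, ⟨haC, hax⟩, hmin⟩ := (isCompact_uIcc.inter_left hCc :
    IsCompact (Uᶜ ∩ Set.uIcc x t)).exists_isMinOn ⟨x, hxC, Set.left_mem_uIcc⟩
    (f := fun y => |y - t|) (by fun_prop)
  have hax' : |a - x| ≤ |t - x| := Set.abs_sub_left_of_mem_uIcc hax
  have hat : |t - a| ≤ |t - x| := Set.abs_sub_right_of_mem_uIcc hax
  have hfree : ∀ τ ∈ Set.uIcc a t, τ ≠ a → τ ∈ U := by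
    intro τ hτ hτa
    by_contra hτU
    have h1 : |a - t| ≤ |τ - t| := hmin ⟨hτU, Set.uIcc_subset_uIcc_right hax hτ⟩
    rcases Set.mem_uIcc.1 hτ with ⟨h2, h3⟩ | ⟨h2, h3⟩
    · rw [abs_of_nonpos (by linarith), abs_of_nonpos (by linarith)] at h1
      exact hτa (by linarith)
    · rw [abs_of_nonneg (by linarith), abs_of_nonneg (by linarith)] at h1
      exact hτa (by linarith)
  have hat' : a ≠ t := fun h => htC (h ▸ haC)
  refine hG k t a (max k (ENNReal.ofReal (G (N t).toReal))) (by linarith) (by simp) ?_ ?_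
  · intro τ hτ
    rcases eq_or_ne τ a with rfl | hτa
    · exact (hNC τ haC (by linarith)).trans (le_max_left _ _)
    · refine le_trans ?_ (le_max_right _ _)
      obtain ⟨B, hB, hNB⟩ := (isCompact_uIcc (a := t) (b := τ)).exists_bound_of_locally_bounded
        (N := N) fun y hy => by
          refine hfree y (Set.uIcc_subset_uIcc Set.right_mem_uIcc hτ hy) ?_
          rintro rfl
          rcases Set.mem_uIcc.1 hτ with ⟨h2, h3⟩ | ⟨h2, h3⟩ <;>
          rcases Set.mem_uIcc.1 hy with ⟨h4, h5⟩ | ⟨h4, h5⟩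
          · exact hat' (by linarith)
          · exact hτa (by linarith)
          · exact hτa (by linarith)
          · exact hat' (by linarith)
      refine hG _ τ t B ?_ hB hNB (by rw [ENNReal.ofReal_toReal (hfin t)])
      have : |τ - t| ≤ |t - a| := by
        rw [abs_sub_comm τ t]
        exact Set.abs_sub_right_of_mem_uIcc hτ
      linarith
  · simpa using hNC a haC (by linarith)

lemma energy_ne_top_of_memHs {s : ℝ} (hs : 0 ≤ s) {u : ℕ → ℂ} (hu : MemHs s u) :
    energy s (amp u) ≠ ∞ := by
  have h : energy s (amp u) ≤
      ∑' n : ℕ, ENNReal.ofReal (2 ^ s * (((1 : ℝ) + (n : ℝ) ^ 2) ^ s * ‖u n‖ ^ 2)) := by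
    refine ENNReal.tsum_le_tsum fun n => ?_
    have h1 : (amp u n) ^ 2 = ENNReal.ofReal (‖u n‖ ^ 2) := by
      rw [ENNReal.ofReal_pow (norm_nonneg _), ofReal_norm]
      rfl
    rw [wt_eq_ofReal, h1, ← ENNReal.ofReal_mul (by positivity), ← mul_assoc,
      ← Real.mul_rpow (by norm_num) (by positivity), Real.rpow_mul (by positivity)]
    refine ENNReal.ofReal_le_ofReal (mul_le_mul_of_nonneg_right ?_ (by positivity))
    refine Real.rpow_le_rpow (by positivity) ?_ hs
    rw [Real.rpow_two]
    nlinarith [sq_nonneg ((n : ℝ) - 1)]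
  exact ne_top_of_le_ne_top (hu.mul_left (2 ^ s)).tsum_ofReal_ne_top h

lemma lowerSemicontinuous_energy {u : ℝ → ℕ → ℂ} (hu : ∀ n, Continuous fun t => u t n) (s : ℝ) :
    LowerSemicontinuous fun t => energy s (amp (u t)) := by
  refine lowerSemicontinuous_tsum fun n => Continuous.lowerSemicontinuous ?_
  exact (ENNReal.continuous_const_mul (wt_ne_top _ _)).comp
    ((ENNReal.continuous_pow 2).comp (ENNReal.continuous_coe.comp (hu n).nnnorm))

lemma SolvesSzego.energy_locally_bounded {α : ℝ} {u : ℝ → ℕ → ℂ} (hsol : SolvesSzego α u) {s : ℝ}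
    (hs : 1 / 2 < s) (hu : ∀ t, MemHs s (u t)) (t₀ : ℝ) :
    ∃ M : ℝ≥0∞, M ≠ ∞ ∧ ∀ᶠ τ in 𝓝 t₀, energy s (amp (u τ)) ≤ M := by
  obtain ⟨G, hG⟩ := exists_energy_growth hsol hs
  refine locally_bounded_of_growth (lowerSemicontinuous_energy (fun n => ?_) s)
    (fun t => energy_ne_top_of_memHs (by linarith) (hu t)) hG t₀
  exact continuous_iff_continuousAt.2 fun t => (hsol n t).continuousAt

lemma sum_norm_elim_rpow_le (f : ℕ ≃. ℕ) (h : Hardy) (s : Finset ℕ) :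
    ∑ k ∈ s, ‖(f k).elim 0 (h : ℕ → ℂ)‖ ^ (2 : ℝ≥0∞).toReal ≤ ‖h‖ ^ (2 : ℝ≥0∞).toReal := by
  have h0 : (0 : ℝ) < (2 : ℝ≥0∞).toReal := by norm_num
  refine le_trans (le_of_eq ?_) (lp.sum_rpow_le_norm_rpow h0 h
    (s.filterMap f fun a a' b hb hb' => f.inj hb hb'))
  have key : ∀ a, ‖(f a).elim 0 (h : ℕ → ℂ)‖ ^ (2 : ℝ≥0∞).toReal ≠ 0 → (f a).isSome := by
    intro a ha
    rcases hfa : f a with _ | b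
    · simp [hfa] at ha
    · rfl
  refine Finset.sum_bij_ne_zero (fun a _ ha => (f a).get (key a ha)) ?_ ?_ ?_ ?_
  · intro a ha h1
    rw [Finset.mem_filterMap]
    exact ⟨a, ha, by simp⟩
  · intro a ha h1 a' ha' h1' heq
    refine f.inj (b := (f a).get (key a h1)) (Option.get_mem _) ?_
    rw [heq]
    exact Option.get_mem _
  · intro b hb hb0
    rw [Finset.mem_filterMap] at hb
    obtain ⟨a, ha, hab⟩ := hb
    exact ⟨a, ha, by simpa [hab] using hb0, by simp [hab]⟩
  · intro a ha h1
    obtain ⟨b, hb⟩ := Option.isSome_iff_exists.1 (key a h1)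
    simp [hb]

/-- Composition of a sequence with a partial injection, as an operator on `ℓ²`. -/
def pcomp (f : ℕ ≃. ℕ) : Hardy →L[ℂ] Hardy :=
  LinearMap.mkContinuous
    { toFun := fun h => ⟨fun k => (f k).elim 0 (h : ℕ → ℂ),
        memℓp_gen' (C := ‖h‖ ^ (2 : ℝ≥0∞).toReal) fun s => sum_norm_elim_rpow_le f h s⟩
      map_add' := fun x y => by
        ext k
        change (f k).elim 0 ((x + y : Hardy) : ℕ → ℂ) =
          (f k).elim 0 (x : ℕ → ℂ) + (f k).elim 0 (y : ℕ → ℂ)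
        rcases f k with _ | a
        · exact (add_zero 0).symm
        · rfl
      map_smul' := fun c x => by
        ext k
        change (f k).elim 0 ((c • x : Hardy) : ℕ → ℂ) = c * (f k).elim 0 (x : ℕ → ℂ)
        rcases f k with _ | a
        · exact (mul_zero c).symm
        · rfl }
    1 fun h => by
      rw [one_mul]
      exact lp.norm_le_of_forall_sum_le (by norm_num) (norm_nonneg _)
        (fun s => sum_norm_elim_rpow_le f h s)

lemma pcomp_apply (f : ℕ ≃. ℕ) (h : Hardy) (k : ℕ) :
    (pcomp f h : ℕ → ℂ) k = (f k).elim 0 (h : ℕ → ℂ) := rfl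

lemma norm_pcomp_le (f : ℕ ≃. ℕ) : ‖pcomp f‖ ≤ 1 :=
  LinearMap.mkContinuous_norm_le _ zero_le_one _

lemma star_pcomp (f : ℕ ≃. ℕ) : star (pcomp f) = pcomp f.symm := by
  rw [ContinuousLinearMap.star_eq_adjoint]
  refine ((ContinuousLinearMap.eq_adjoint_iff _ _).2 fun x y => ?_).symm
  rw [lp.inner_eq_tsum, lp.inner_eq_tsum]
  simp only [pcomp_apply]
  have key : ∀ a : Function.support fun k => inner ℂ ((x : ℕ → ℂ) k) ((f k).elim 0 (y : ℕ → ℂ)),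
      (f a).isSome := by
    rintro ⟨a, ha⟩
    rcases hfa : f a with _ | b
    · simp [hfa] at ha
    · simp
  refine tsum_eq_tsum_of_ne_zero_bij (fun a => (f a).get (key a)) ?_ ?_ ?_
  · intro a a' h
    refine Subtype.ext (f.inj (b := (f a).get (key a)) (Option.get_mem _) ?_)
    change (f a).get (key a) = (f a').get (key a') at h
    rw [h]
    exact Option.get_mem _
  · intro b hb
    rcases hfb : f.symm b with _ | a
    · simp [hfb] at hb
    · have hab : f a = some b := (f.eq_some_iff).1 hfb
      refine ⟨⟨a, ?_⟩, by simp [hab]⟩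
      simpa [hfb, hab] using hb
  · intro a
    obtain ⟨b, hb⟩ := Option.isSome_iff_exists.1 (key a)
    have : f.symm b = some (a : ℕ) := (f.eq_some_iff).2 hb
    simp [hb, this]

/-- The partial injection `k ↦ k - n`. -/
def subPEquiv (n : ℕ) : ℕ ≃. ℕ where
  toFun k := if n ≤ k then some (k - n) else none
  invFun k := some (k + n)
  inv k l := by
    split_ifs
    · simp
      omega
    · simp
      omega

/-- The partial involution `k ↦ n - 1 - k`. -/
def reflPEquiv (n : ℕ) : ℕ ≃. ℕ where
  toFun k := if k < n then some (n - 1 - k) else none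
  invFun k := if k < n then some (n - 1 - k) else none
  inv k l := by
    split_ifs
    · simp
      omega
    · simp
      omega
    · simp
      omega
    · simp

/-- Multiplication by `z ^ n`. -/
def shiftOp (n : ℕ) : Hardy →L[ℂ] Hardy := pcomp (subPEquiv n)

/-- The adjoint of the multiplication by `z ^ n`. -/
def coshiftOp (n : ℕ) : Hardy →L[ℂ] Hardy := pcomp (subPEquiv n).symm

/-- The linear version of the shifted Hankel operator of symbol `z ^ n`. -/
def reflOp (n : ℕ) : Hardy →L[ℂ] Hardy := pcomp (reflPEquiv n)

lemma shiftOp_apply (n : ℕ) (h : Hardy) (k : ℕ) :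
    (shiftOp n h : ℕ → ℂ) k = if n ≤ k then (h : ℕ → ℂ) (k - n) else 0 := by
  rw [shiftOp, pcomp_apply]
  change (if n ≤ k then some (k - n) else none).elim 0 _ = _
  split_ifs <;> rfl

lemma coshiftOp_apply (n : ℕ) (h : Hardy) (k : ℕ) :
    (coshiftOp n h : ℕ → ℂ) k = (h : ℕ → ℂ) (k + n) := rfl

lemma reflOp_apply (n : ℕ) (h : Hardy) (k : ℕ) :
    (reflOp n h : ℕ → ℂ) k = if k < n then (h : ℕ → ℂ) (n - 1 - k) else 0 := by
  rw [reflOp, pcomp_apply]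
  change (if k < n then some (n - 1 - k) else none).elim 0 _ = _
  split_ifs <;> rfl

lemma star_shiftOp (n : ℕ) : star (shiftOp n) = coshiftOp n := star_pcomp _

lemma star_reflOp (n : ℕ) : star (reflOp n) = reflOp n := star_pcomp _

lemma coshiftOp_mul_shiftOp (m n : ℕ) :
    coshiftOp m * shiftOp n = shiftOp n * coshiftOp m + reflOp n * reflOp m := by
  ext h k
  simp only [mul_apply_eq_comp, add_apply, lp.coeFn_add,
    Pi.add_apply, shiftOp_apply, coshiftOp_apply, reflOp_apply]
  split_ifs <;> 
    first
    | omega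
    | (simp only [add_zero, zero_add]; try exact congrArg (h : ℕ → ℂ) (by omega))

lemma shiftOp_mul_reflOp_add (a c : ℕ) :
    shiftOp a * reflOp c + reflOp a * coshiftOp c = reflOp (a + c) := by
  ext h k
  simp only [mul_apply_eq_comp, add_apply, lp.coeFn_add,
    Pi.add_apply, shiftOp_apply, coshiftOp_apply, reflOp_apply]
  split_ifs <;> 
    first
    | omega
    | (simp only [add_zero, zero_add]; try exact congrArg (h : ℕ → ℂ) (by omega))

lemma coshiftOp_mul_reflOp (b m : ℕ) : coshiftOp b * reflOp m = reflOp (m - b) := by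
  ext h k
  simp only [mul_apply_eq_comp, coshiftOp_apply, reflOp_apply]
  split_ifs <;> first | omega | rfl | exact congrArg (h : ℕ → ℂ) (by omega)

lemma reflOp_mul_shiftOp (b m : ℕ) : reflOp m * shiftOp b = reflOp (m - b) := by
  ext h k
  simp only [mul_apply_eq_comp, shiftOp_apply, reflOp_apply]
  split_ifs <;> first | omega | rfl | exact congrArg (h : ℕ → ℂ) (by omega)

lemma shiftOp_mul_shiftOp (a c : ℕ) : shiftOp a * shiftOp c = shiftOp (a + c) := by
  ext h k
  simp only [mul_apply_eq_comp, shiftOp_apply]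
  split_ifs <;> first | omega | rfl | exact congrArg (h : ℕ → ℂ) (by omega)

lemma coshiftOp_mul_shiftOp_of_le {b m : ℕ} (h : b ≤ m) :
    coshiftOp b * shiftOp m = shiftOp (m - b) := by
  ext x k
  simp only [mul_apply_eq_comp, shiftOp_apply, coshiftOp_apply]
  split_ifs <;> first | omega | rfl | exact congrArg (x : ℕ → ℂ) (by omega)

lemma reflOp_zero : reflOp 0 = 0 := by
  ext h k
  simp [reflOp_apply]

lemma coe_oneH (k : ℕ) : (oneH : ℕ → ℂ) k = if k = 0 then 1 else 0 := by
  rw [oneH, lp.single_apply, Pi.single_apply]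

lemma coshiftOp_oneH (n : ℕ) : coshiftOp n oneH = if n = 0 then oneH else 0 := by
  ext k
  rw [coshiftOp_apply]
  split_ifs with h
  · simp [h]
  · simp [coe_oneH, h]

lemma coshiftOp_shiftOp_oneH {b m : ℕ} (h : m < b) : coshiftOp b (shiftOp m oneH) = 0 := by
  ext k
  rw [coshiftOp_apply, shiftOp_apply, coe_oneH]
  simp
  omega

/-- The operator `∑ w n • F n`. -/
def opSum (F : ℕ → Hardy →L[ℂ] Hardy) (w : ℕ → ℂ) : Hardy →L[ℂ] Hardy := ∑' n, w n • F n

section OpSum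

variable {F F' : ℕ → Hardy →L[ℂ] Hardy} {w w' : ℕ → ℂ}

lemma norm_shiftOp_le (n : ℕ) : ‖shiftOp n‖ ≤ 1 := norm_pcomp_le _

lemma norm_coshiftOp_le (n : ℕ) : ‖coshiftOp n‖ ≤ 1 := norm_pcomp_le _

lemma norm_reflOp_le (n : ℕ) : ‖reflOp n‖ ≤ 1 := norm_pcomp_le _

lemma norm_smul_le_of_le_one {z : ℂ} {A : Hardy →L[ℂ] Hardy} (hA : ‖A‖ ≤ 1) : ‖z • A‖ ≤ ‖z‖ := by
  rw [norm_smul]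
  exact mul_le_of_le_one_right (norm_nonneg _) hA

lemma summable_norm_smul (hF : ∀ n, ‖F n‖ ≤ 1) (hw : Summable fun n => ‖w n‖) :
    Summable fun n => ‖w n • F n‖ :=
  hw.of_nonneg_of_le (fun _ => norm_nonneg _) fun n => norm_smul_le_of_le_one (hF n)

lemma summable_opSum_mul (hF : ∀ n, ‖F n‖ ≤ 1) (hF' : ∀ n, ‖F' n‖ ≤ 1)
    (hw : Summable fun n => ‖w n‖) (hw' : Summable fun n => ‖w' n‖) :
    Summable fun p : ℕ × ℕ => (w p.1 * w' p.2) • (F p.1 * F' p.2) := by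
  simpa only [smul_mul_smul_comm] using
    summable_mul_of_summable_norm (summable_norm_smul hF hw) (summable_norm_smul hF' hw')

lemma opSum_mul (hF : ∀ n, ‖F n‖ ≤ 1) (hF' : ∀ n, ‖F' n‖ ≤ 1)
    (hw : Summable fun n => ‖w n‖) (hw' : Summable fun n => ‖w' n‖) :
    opSum F w * opSum F' w' = ∑' p : ℕ × ℕ, (w p.1 * w' p.2) • (F p.1 * F' p.2) := by
  simpa only [smul_mul_smul_comm, opSum] using
    tsum_mul_tsum_of_summable_norm (summable_norm_smul hF hw) (summable_norm_smul hF' hw')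

lemma opSum_mul' (hF : ∀ n, ‖F n‖ ≤ 1) (hF' : ∀ n, ‖F' n‖ ≤ 1)
    (hw : Summable fun n => ‖w n‖) (hw' : Summable fun n => ‖w' n‖) :
    opSum F w * opSum F' w' = ∑' p : ℕ × ℕ, (w p.2 * w' p.1) • (F p.2 * F' p.1) := by
  rw [opSum_mul hF hF' hw hw',
    ← (Equiv.prodComm ℕ ℕ).tsum_eq fun p : ℕ × ℕ => (w p.1 * w' p.2) • (F p.1 * F' p.2)]
  rfl

lemma summable_opSum_mul' (hF : ∀ n, ‖F n‖ ≤ 1) (hF' : ∀ n, ‖F' n‖ ≤ 1)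
    (hw : Summable fun n => ‖w n‖) (hw' : Summable fun n => ‖w' n‖) :
    Summable fun p : ℕ × ℕ => (w p.2 * w' p.1) • (F p.2 * F' p.1) :=
  (summable_opSum_mul hF hF' hw hw').prod_symm

lemma coshift_mul_shift (hw : Summable fun n => ‖w n‖) (hw' : Summable fun n => ‖w' n‖) :
    opSum coshiftOp w' * opSum shiftOp w =
      opSum shiftOp w * opSum coshiftOp w' + opSum reflOp w * opSum reflOp w' := by
  rw [opSum_mul norm_coshiftOp_le norm_shiftOp_le hw' hw,
    opSum_mul' norm_shiftOp_le norm_coshiftOp_le hw hw',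
    opSum_mul' norm_reflOp_le norm_reflOp_le hw hw',
    ← (summable_opSum_mul' norm_shiftOp_le norm_coshiftOp_le hw hw').tsum_add
      (summable_opSum_mul' norm_reflOp_le norm_reflOp_le hw hw')]
  refine tsum_congr fun p => ?_
  rw [coshiftOp_mul_shiftOp, smul_add, mul_comm (w p.2)]

lemma coshift_mul_refl (hw : Summable fun n => ‖w n‖) (hw' : Summable fun n => ‖w' n‖) :
    opSum coshiftOp w' * opSum reflOp w = opSum reflOp w * opSum shiftOp w' := by
  rw [opSum_mul norm_coshiftOp_le norm_reflOp_le hw' hw,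
    opSum_mul' norm_reflOp_le norm_shiftOp_le hw hw']
  refine tsum_congr fun p => ?_
  rw [coshiftOp_mul_reflOp, reflOp_mul_shiftOp, mul_comm (w p.2)]

lemma norm_mul_le_one {A B : Hardy →L[ℂ] Hardy} (hA : ‖A‖ ≤ 1) (hB : ‖B‖ ≤ 1) : ‖A * B‖ ≤ 1 :=
  (norm_mul_le _ _).trans (mul_le_one₀ hA (norm_nonneg _) hB)

lemma summable_norm_mul_smul {E : ℕ × ℕ → Hardy →L[ℂ] Hardy} (hE : ∀ p, ‖E p‖ ≤ 1)
    (hw : Summable fun n => ‖w n‖) (hw' : Summable fun n => ‖w' n‖) :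
    Summable fun p : ℕ × ℕ => ‖(w p.1 * w' p.2) • E p‖ :=
  (hw.mul_norm hw').of_nonneg_of_le (fun _ => norm_nonneg _) fun p =>
    norm_smul_le_of_le_one (hE p)

lemma shift_mul_refl_add (hw : Summable fun n => ‖w n‖) :
    opSum shiftOp w * opSum reflOp w + opSum reflOp w * opSum coshiftOp w =
      ∑' p : ℕ × ℕ, (w p.1 * w p.2) • reflOp (p.1 + p.2) := by
  rw [opSum_mul norm_shiftOp_le norm_reflOp_le hw hw,
    opSum_mul norm_reflOp_le norm_coshiftOp_le hw hw,
    ← (summable_opSum_mul norm_shiftOp_le norm_reflOp_le hw hw).tsum_add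
      (summable_opSum_mul norm_reflOp_le norm_coshiftOp_le hw hw)]
  refine tsum_congr fun p => ?_
  rw [← smul_add, shiftOp_mul_reflOp_add]

lemma shift_mul_shift (hw : Summable fun n => ‖w n‖) :
    opSum shiftOp w * opSum shiftOp w =
      ∑' p : ℕ × ℕ, (w p.1 * w p.2) • shiftOp (p.1 + p.2) := by
  rw [opSum_mul norm_shiftOp_le norm_shiftOp_le hw hw]
  exact tsum_congr fun p => by rw [shiftOp_mul_shiftOp]

lemma opSum_mul_tsum {E : ℕ × ℕ → Hardy →L[ℂ] Hardy} (hE : ∀ p, ‖E p‖ ≤ 1)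
    (hF : ∀ n, ‖F n‖ ≤ 1) (hw : Summable fun n => ‖w n‖) (hw' : Summable fun n => ‖w' n‖) :
    opSum F w' * ∑' p : ℕ × ℕ, (w p.1 * w p.2) • E p =
      ∑' q : ℕ × ℕ × ℕ, (w q.1 * w' q.2.1 * w q.2.2) • (F q.2.1 * E (q.1, q.2.2)) := by
  let e : ℕ × ℕ × ℕ ≃ ℕ × ℕ × ℕ :=
    ⟨fun q => (q.2.1, q.1, q.2.2), fun q => (q.2.1, q.1, q.2.2), fun _ => rfl, fun _ => rfl⟩
  rw [opSum, tsum_mul_tsum_of_summable_norm (summable_norm_smul hF hw')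
    (summable_norm_mul_smul hE hw hw), ← e.tsum_eq]
  refine tsum_congr fun q => ?_
  change (w' q.2.1 • F q.2.1) * ((w q.1 * w q.2.2) • E (q.1, q.2.2)) = _
  rw [smul_mul_smul_comm]
  congr 1
  ring

end OpSum

lemma wiener_zero_amp (w : ℕ → ℂ) : wiener 0 (amp w) = ∑' n, ‖w n‖ₑ :=
  tsum_congr fun n => by simp [wt, amp, enorm_eq_nnnorm]

lemma opSum_cubic {w : ℕ → ℂ} (hw : Summable fun n => ‖w n‖) {E : Type*} [NormedAddCommGroup E]
    [NormedSpace ℂ E] [CompleteSpace E] {F : ℕ → E} (hF : ∀ n, ‖F n‖ ≤ 1) :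
    ∑' n, cubic w n • F n = ∑' q : ℕ × ℕ × ℕ, (w q.1 * conj (w q.2.1) * w q.2.2) •
      (if q.2.1 ≤ q.1 + q.2.2 then F (q.1 + q.2.2 - q.2.1) else 0) := by
  set f : ℕ → ℕ × ℕ × ℕ → ℂ := fun n q =>
    if q.1 + q.2.2 = q.2.1 + n then w q.1 * conj (w q.2.1) * w q.2.2 else 0 with hf
  have hfin : ∑' n, ∑' q, ‖f n q‖ₑ ≠ ∞ := by
    have h1 : wiener 0 (amp w) ≠ ∞ := by
      rw [wiener_zero_amp]
      exact tsum_enorm_ne_top_iff_summable_norm.2 hw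
    refine ne_top_of_le_ne_top (ENNReal.pow_ne_top h1)
      (le_trans (le_of_eq ?_) (wiener_cubicMajorant_le le_rfl (amp w)))
    refine tsum_congr fun n => ?_
    rw [wt, ENNReal.rpow_zero, one_mul, cubicMajorant]
    refine tsum_congr fun q => ?_
    simp only [hf]
    split_ifs <;> simp [amp, enorm_eq_nnnorm]
  have hfs : Summable fun p : ℕ × ℕ × ℕ × ℕ => f p.1 p.2 :=
    Summable.of_enorm (by rwa [ENNReal.tsum_prod'])
  have hs : Summable (Function.uncurry fun n q => f n q • F n) := by
    refine Summable.of_norm (hfs.norm.of_nonneg_of_le (fun _ => norm_nonneg _) fun p => ?_)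
    simp only [Function.uncurry]
    rw [norm_smul]
    exact mul_le_of_le_one_right (norm_nonneg _) (hF _)
  calc ∑' n, cubic w n • F n = ∑' n, ∑' q, f n q • F n := by
        refine tsum_congr fun n => ?_
        rw [cubic, (hfs.prod_factor n).tsum_smul_const]
    _ = ∑' q, ∑' n, f n q • F n := hs.tsum_comm.symm
    _ = _ := by
        refine tsum_congr fun q => ?_
        split_ifs with h
        · rw [tsum_eq_single (q.1 + q.2.2 - q.2.1)]
          · simp only [hf]
            rw [if_pos (by omega)]
          · intro n hn
            simp only [hf]
            rw [if_neg (by omega), zero_smul]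
        · rw [smul_zero]
          refine (tsum_congr fun n => ?_).trans tsum_zero
          simp only [hf]
          rw [if_neg (by omega), zero_smul]

lemma norm_oneH : ‖oneH‖ = 1 := by
  simp [oneH]

/-- The Hankel identity for the cubic nonlinearity. -/
lemma opSum_reflOp_cubic {w : ℕ → ℂ} (hw : Summable fun n => ‖w n‖) :
    opSum reflOp (cubic w) =
      opSum coshiftOp (star w) * opSum shiftOp w * opSum reflOp w +
        opSum reflOp w * (opSum coshiftOp w * opSum shiftOp (star w)) -
        opSum reflOp w * opSum reflOp (star w) * opSum reflOp w := by
  have hw' : Summable fun n => ‖(star w) n‖ := by simpa using hw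
  have h1 : opSum reflOp (cubic w) = opSum coshiftOp (star w) *
      (opSum shiftOp w * opSum reflOp w + opSum reflOp w * opSum coshiftOp w) := by
    rw [shift_mul_refl_add hw, opSum_mul_tsum (E := fun p => reflOp (p.1 + p.2))
      (fun p => norm_reflOp_le _) norm_coshiftOp_le hw hw', opSum,
      opSum_cubic hw norm_reflOp_le]
    refine tsum_congr fun q => ?_
    rw [coshiftOp_mul_reflOp]
    split_ifs with h
    · rfl
    · rw [Nat.sub_eq_zero_of_le (by omega), reflOp_zero, smul_zero, smul_zero]
  rw [h1, mul_add, ← mul_assoc, ← mul_assoc (opSum coshiftOp (star w)) (opSum reflOp w),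
    coshift_mul_refl hw hw', coshift_mul_shift hw' hw]
  noncomm_ring

lemma opSum_apply {F : ℕ → Hardy →L[ℂ] Hardy} (hF : ∀ n, ‖F n‖ ≤ 1) {w : ℕ → ℂ}
    (hw : Summable fun n => ‖w n‖) (x : Hardy) : opSum F w x = ∑' n, w n • F n x :=
  (ContinuousLinearMap.apply ℂ Hardy x).map_tsum (summable_norm_smul hF hw).of_norm

/-- The Toeplitz representation of the cubic nonlinearity. -/
lemma opSum_shiftOp_cubic {w : ℕ → ℂ} (hw : Summable fun n => ‖w n‖)
    (hc : Summable fun n => ‖cubic w n‖) :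
    opSum shiftOp (cubic w) oneH =
      (opSum coshiftOp (star w) * opSum shiftOp w) (opSum shiftOp w oneH) := by
  have hw' : Summable fun n => ‖(star w) n‖ := by simpa using hw
  have hs : Summable fun q : ℕ × ℕ × ℕ => (w q.1 * star w q.2.1 * w q.2.2) •
      (coshiftOp q.2.1 * shiftOp (q.1 + q.2.2)) := by
    refine Summable.of_norm (((hw.mul_norm (hw'.mul_norm hw))).of_nonneg_of_le
      (fun _ => norm_nonneg _) fun q => ?_)
    rw [mul_assoc]
    exact norm_smul_le_of_le_one (norm_mul_le_one (norm_coshiftOp_le _) (norm_shiftOp_le _))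
  rw [← mul_apply_eq_comp, mul_assoc, shift_mul_shift hw,
    opSum_mul_tsum (E := fun p => shiftOp (p.1 + p.2)) (fun p => norm_shiftOp_le _)
      norm_coshiftOp_le hw hw', opSum_apply norm_shiftOp_le hc,
    opSum_cubic hw (F := fun n => shiftOp n oneH)
      (fun n => ((shiftOp n).le_of_opNorm_le (norm_shiftOp_le n) _).trans (by simp [norm_oneH]))]
  refine Eq.trans ?_ ((ContinuousLinearMap.apply ℂ Hardy oneH).map_tsum hs).symm
  refine tsum_congr fun q => ?_
  change _ = (w q.1 * star w q.2.1 * w q.2.2) • coshiftOp q.2.1 (shiftOp (q.1 + q.2.2) oneH)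
  split_ifs with h
  · rw [← coshiftOp_mul_shiftOp_of_le h]
    rfl
  · rw [coshiftOp_shiftOp_oneH (by omega)]
    rfl

lemma opSum_coshiftOp_oneH {w : ℕ → ℂ} (hw : Summable fun n => ‖w n‖) :
    opSum coshiftOp w oneH = w 0 • oneH := by
  rw [opSum_apply norm_coshiftOp_le hw, tsum_eq_single 0]
  · simp [coshiftOp_oneH]
  · intro n hn
    simp [coshiftOp_oneH, hn]

lemma star_opSum (F : ℕ → Hardy →L[ℂ] Hardy) (w : ℕ → ℂ) :
    star (opSum F w) = opSum (fun n => star (F n)) (star w) := by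
  rw [opSum, tsum_star]
  simp_rw [star_smul]
  rfl

lemma star_opSum_shiftOp (w : ℕ → ℂ) :
    star (opSum shiftOp w) = opSum coshiftOp (star w) := by
  rw [star_opSum]
  simp_rw [star_shiftOp]

lemma star_opSum_reflOp (w : ℕ → ℂ) :
    star (opSum reflOp w) = opSum reflOp (star w) := by
  rw [star_opSum]
  simp_rw [star_reflOp]

lemma coe_tsum_apply {f : ℕ → Hardy} (hf : Summable f) (k : ℕ) :
    ((∑' n, f n : Hardy) : ℕ → ℂ) k = ∑' n, (f n : ℕ → ℂ) k :=
  (lp.evalCLM ℂ (fun _ : ℕ => ℂ) 2 k).map_tsum hf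

lemma opSum_apply_apply {F : ℕ → Hardy →L[ℂ] Hardy} (hF : ∀ n, ‖F n‖ ≤ 1) {w : ℕ → ℂ}
    (hw : Summable fun n => ‖w n‖) (x : Hardy) (k : ℕ) :
    (opSum F w x : ℕ → ℂ) k = ∑' n, w n * (F n x : ℕ → ℂ) k := by
  rw [opSum_apply hF hw, coe_tsum_apply]
  · rfl
  · exact ((summable_norm_smul hF hw).of_norm).mapL (ContinuousLinearMap.apply ℂ Hardy x)

lemma opSum_shiftOp_oneH_apply {w : ℕ → ℂ} (hw : Summable fun n => ‖w n‖) (k : ℕ) :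
    (opSum shiftOp w oneH : ℕ → ℂ) k = w k := by
  rw [opSum_apply_apply norm_shiftOp_le hw, tsum_eq_single k]
  · simp [shiftOp_apply, coe_oneH]
  · intro n hn
    rw [shiftOp_apply, coe_oneH]
    split_ifs <;> first | omega | simp

lemma opSum_reflOp_apply {w : ℕ → ℂ} (hw : Summable fun n => ‖w n‖) (h : Hardy) (k : ℕ) :
    (opSum reflOp w h : ℕ → ℂ) k = ∑' l, w (k + 1 + l) * (h : ℕ → ℂ) l := by
  rw [opSum_apply_apply norm_reflOp_le hw]
  have hinj : Function.Injective fun l : ℕ => k + 1 + l := fun a b hab => by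
    simpa using hab
  rw [← hinj.tsum_eq]
  · refine tsum_congr fun l => ?_
    rw [reflOp_apply, if_pos (by omega), show k + 1 + l - 1 - k = l by omega]
  · intro n hn
    have : k < n := by
      by_contra hkn
      exact hn (by simp [reflOp_apply, hkn])
    exact ⟨n - (k + 1), by simp only; omega⟩

/-- `K_u²` as an operator. -/
def kOp (w : ℕ → ℂ) : Hardy →L[ℂ] Hardy := opSum reflOp w * opSum reflOp (star w)

lemma ku2_coe {w : ℕ → ℂ} (hw : Summable fun n => ‖w n‖) (h : Hardy) :
    ku2 w h = (kOp w h : ℕ → ℂ) := by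
  have hw' : Summable fun n => ‖(star w) n‖ := by simpa using hw
  ext k
  rw [kOp, mul_apply_eq_comp, opSum_reflOp_apply hw, ku2, khankel]
  refine tsum_congr fun l => ?_
  rw [opSum_reflOp_apply hw', khankel, Complex.conj_tsum]
  congr 1
  refine tsum_congr fun m => ?_
  simp

lemma isSelfAdjoint_kOp (w : ℕ → ℂ) : IsSelfAdjoint (kOp w) := by
  rw [kOp, ← star_opSum_reflOp]
  exact .mul_star_self _

lemma SolvesSzego.wiener_locally_bounded {α : ℝ} {u : ℝ → ℕ → ℂ} (hsol : SolvesSzego α u) {s : ℝ}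
    (hs : 1 / 2 < s) (hu : ∀ t, MemHs s (u t)) (t₀ : ℝ) :
    ∃ ε : ℝ, 0 < ε ∧ ∃ C : ℝ≥0∞, C ≠ ∞ ∧ ∀ᶠ τ in 𝓝 t₀, wiener ε (amp (u τ)) ≤ C := by
  obtain ⟨M, hM, hev⟩ := hsol.energy_locally_bounded hs hu t₀
  refine ⟨(s - 1 / 2) / 2, by linarith, _,
    ENNReal.add_ne_top.2 ⟨tsum_wt_ne_top (r := 2 * ((s - 1 / 2) / 2 - s)) (by linarith), hM⟩,
    hev.mono fun τ hτ => (wiener_le_add_energy _ s _).trans (by gcongr)⟩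

lemma summable_norm_of_wiener_ne_top {r : ℝ} (hr : 0 ≤ r) {w : ℕ → ℂ}
    (h : wiener r (fun n => ‖w n‖ₑ) ≠ ∞) : Summable fun n => ‖w n‖ :=
  tsum_enorm_ne_top_iff_summable_norm.1 (ne_top_of_le_ne_top h (tsum_le_wiener hr _))

lemma SolvesSzego.summable_norm {α : ℝ} {u : ℝ → ℕ → ℂ} (hsol : SolvesSzego α u) {s : ℝ}
    (hs : 1 / 2 < s) (hu : ∀ t, MemHs s (u t)) (t : ℝ) : Summable fun n => ‖u t n‖ := by
  obtain ⟨ε, hε, C, hC, hev⟩ := hsol.wiener_locally_bounded hs hu t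
  exact summable_norm_of_wiener_ne_top hε.le (ne_top_of_le_ne_top hC hev.self_of_nhds)

lemma wiener_enorm_cubic_le {r : ℝ} (hr : 0 ≤ r) (w : ℕ → ℂ) :
    wiener r (fun n => ‖cubic w n‖ₑ) ≤ wiener r (amp w) ^ 3 := by
  refine le_trans ?_ (wiener_cubicMajorant_le hr _)
  exact ENNReal.tsum_le_tsum fun n => by gcongr; exact enorm_cubic_le_amp w n

lemma SolvesSzego.summable_norm_cubic {α : ℝ} {u : ℝ → ℕ → ℂ} (hsol : SolvesSzego α u) {s : ℝ}
    (hs : 1 / 2 < s) (hu : ∀ t, MemHs s (u t)) (t : ℝ) : Summable fun n => ‖cubic (u t) n‖ := by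
  obtain ⟨ε, hε, C, hC, hev⟩ := hsol.wiener_locally_bounded hs hu t
  exact summable_norm_of_wiener_ne_top hε.le (ne_top_of_le_ne_top
    (ENNReal.pow_ne_top (ne_top_of_le_ne_top hC hev.self_of_nhds)) (wiener_enorm_cubic_le hε.le _))

lemma enorm_opSum_sub_sum_le {F : ℕ → Hardy →L[ℂ] Hardy} (hF : ∀ n, ‖F n‖ ≤ 1) {w : ℕ → ℂ}
    (hw : Summable fun n => ‖w n‖) (K : ℕ) :
    ‖opSum F w - ∑ n ∈ Finset.range K, w n • F n‖ₑ ≤ ∑' n, ‖w (n + K)‖ₑ := by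
  have h := (summable_norm_smul hF hw).of_norm
  have h1 : opSum F w - ∑ n ∈ Finset.range K, w n • F n = ∑' n, w (n + K) • F (n + K) := by
    rw [opSum, ← h.sum_add_tsum_nat_add K]
    abel
  rw [h1]
  refine (enorm_tsum_le_tsum_enorm (f := fun n => w (n + K) • F (n + K))).trans
    (ENNReal.tsum_le_tsum fun n => ?_)
  exact enorm_le_iff_norm_le.2 (norm_smul_le_of_le_one (hF _))

lemma tendsto_div_wt_atTop {ε : ℝ} (hε : 0 < ε) {C : ℝ≥0∞} (hC : C ≠ ∞) :
    Tendsto (fun K => C / wt ε K) atTop (𝓝 0) := by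
  rw [← ENNReal.div_top (a := C)]
  refine ENNReal.Tendsto.const_div ?_ (Or.inr hC)
  have h : Tendsto (fun n : ℕ => ((n : ℝ) + 1) ^ ε) atTop atTop :=
    (tendsto_rpow_atTop hε).comp (tendsto_atTop_add_const_right _ _ tendsto_natCast_atTop_atTop)
  exact (ENNReal.tendsto_ofReal_atTop.comp h).congr fun n => (wt_eq_ofReal ε n).symm

/-- Time derivative of the coefficients of a solution. -/
def szegoField (α : ℝ) (w : ℕ → ℂ) (n : ℕ) : ℂ :=
  -Complex.I * (cubic w n + (α : ℂ) * w 0 * oneSeq n)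

lemma enorm_szegoField_add_one (α : ℝ) (w : ℕ → ℂ) (n : ℕ) :
    ‖szegoField α w (n + 1)‖ₑ = ‖cubic w (n + 1)‖ₑ := by
  simp [szegoField, oneSeq, enorm_eq_nnnorm]

lemma summable_norm_szegoField (α : ℝ) {w : ℕ → ℂ} (hc : Summable fun n => ‖cubic w n‖) :
    Summable fun n => ‖szegoField α w n‖ := by
  rw [← summable_nat_add_iff 1] at hc ⊢
  refine hc.congr fun n => ?_
  simp [szegoField, oneSeq]

lemma opSum_szegoField {F : ℕ → Hardy →L[ℂ] Hardy} (hF : ∀ n, ‖F n‖ ≤ 1) (α : ℝ) {w : ℕ → ℂ}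
    (hc : Summable fun n => ‖cubic w n‖) :
    opSum F (szegoField α w) = -Complex.I • (opSum F (cubic w) + ((α : ℂ) * w 0) • F 0) := by
  have h := (summable_norm_smul hF hc).of_norm
  have h0 : HasSum (fun n => ((α : ℂ) * w 0 * oneSeq n) • F n) (((α : ℂ) * w 0) • F 0) := by
    convert hasSum_ite_eq (0 : ℕ) (((α : ℂ) * w 0) • F 0) using 2 with n
    by_cases hn : n = 0 <;> simp [oneSeq, hn]
  refine Eq.trans ?_ ((h.hasSum.add h0).const_smul (-Complex.I)).tsum_eq
  refine tsum_congr fun n => ?_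
  rw [szegoField, mul_smul, add_smul]

lemma SolvesSzego.hasDerivAt_opSum {α : ℝ} {u : ℝ → ℕ → ℂ} (hsol : SolvesSzego α u) {s : ℝ}
    (hs : 1 / 2 < s) (hu : ∀ t, MemHs s (u t)) {F : ℕ → Hardy →L[ℂ] Hardy} (hF : ∀ n, ‖F n‖ ≤ 1)
    (t : ℝ) :
    HasDerivAt (fun τ => opSum F (u τ))
      (-Complex.I • (opSum F (cubic (u t)) + ((α : ℂ) * u t 0) • F 0)) t := by
  obtain ⟨ε, hε, C, hC, hev⟩ := hsol.wiener_locally_bounded hs hu t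
  obtain ⟨S, hS, hSo, htS⟩ := eventually_nhds_iff.1 hev
  rw [← opSum_szegoField hF α (hsol.summable_norm_cubic hs hu t)]
  refine hasDerivAt_of_tendstoUniformlyOn (l := atTop) (s := S)
    (f := fun K τ => ∑ n ∈ Finset.range K, u τ n • F n)
    (f' := fun K τ => ∑ n ∈ Finset.range K, szegoField α (u τ) n • F n)
    (g' := fun τ => opSum F (szegoField α (u τ))) hSo ?_ ?_ ?_ htS
  · rw [EMetric.tendstoUniformlyOn_iff]
    intro δ hδ
    filter_upwards
      [(tendsto_div_wt_atTop hε (ENNReal.pow_ne_top (n := 3) hC)).eventually_lt_const hδ,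
      eventually_ge_atTop 1] with K hK hK1 τ hτ
    refine lt_of_le_of_lt ?_ hK
    rw [edist_eq_enorm_sub]
    refine (enorm_opSum_sub_sum_le hF (summable_norm_szegoField α
      (hsol.summable_norm_cubic hs hu τ)) K).trans ?_
    obtain ⟨K, rfl⟩ := Nat.exists_eq_add_of_le' hK1
    simp_rw [← add_assoc, enorm_szegoField_add_one, add_assoc]
    rw [ENNReal.le_div_iff_mul_le (.inl (wt_ne_zero _ _)) (.inl (wt_ne_top _ _)), mul_comm]
    refine (tail_le hε.le (fun n => ‖cubic (u τ) n‖ₑ) _).trans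
      ((wiener_enorm_cubic_le hε.le _).trans ?_)
    gcongr
    exact hS τ hτ
  · refine .of_forall fun K x _ => ?_
    exact .fun_sum fun n _ => (hsol n x).smul_const (F n)
  · exact fun x _ => (summable_norm_smul hF
      (hsol.summable_norm hs hu x)).of_norm.hasSum.tendsto_sum_nat

section Conservation

variable {α : ℝ}

lemma HasDerivAt.commutator_pow {G : ℝ → Hardy →L[ℂ] Hardy} {T : Hardy →L[ℂ] Hardy} {t : ℝ}
    (hG : HasDerivAt G (-Complex.I • (T * G t - G t * T)) t) (k : ℕ) :
    HasDerivAt (fun τ => G τ ^ k) (-Complex.I • (T * G t ^ k - G t ^ k * T)) t := by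
  induction k with
  | zero => simpa using hasDerivAt_const t (1 : Hardy →L[ℂ] Hardy)
  | succ k ih =>
    refine (ih.mul hG).congr_deriv ?_ |>.congr_of_eventuallyEq
      (.of_forall fun τ => pow_succ (G τ) k)
    rw [pow_succ]
    simp only [smul_mul_assoc, mul_smul_comm, ← smul_add]
    noncomm_ring

/-- The quadratic functional attached to an operator, a vector and the constant function `1`. -/
def lForm (α : ℝ) (U : Hardy) (A : Hardy →L[ℂ] Hardy) : ℂ :=
  inner ℂ U (A U) - (α : ℂ) * inner ℂ oneH (A oneH)

lemma lForm_add (α : ℝ) (U : Hardy) (A B : Hardy →L[ℂ] Hardy) :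
    lForm α U (A + B) = lForm α U A + lForm α U B := by
  simp only [lForm, add_apply, inner_add_right]
  ring

lemma lForm_smul (α : ℝ) (U : Hardy) (c : ℂ) (A : Hardy →L[ℂ] Hardy) :
    lForm α U (c • A) = c * lForm α U A := by
  simp only [lForm, smul_apply, inner_smul_right]
  ring

lemma hasDerivAt_lForm_pow {G : ℝ → Hardy →L[ℂ] Hardy} {U : ℝ → Hardy} {T : Hardy →L[ℂ] Hardy}
    {c : ℂ} {t : ℝ} (hG : HasDerivAt G (-Complex.I • (T * G t - G t * T)) t)
    (hU : HasDerivAt U (-Complex.I • (T (U t) + ((α : ℂ) * c) • oneH)) t)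
    (hT : IsSelfAdjoint T) (hGs : IsSelfAdjoint (G t))
    (hT1 : T oneH = G t oneH + conj c • U t) (k : ℕ) :
    HasDerivAt (fun τ => lForm α (U τ) (G τ ^ k)) 0 t := by
  have hGk := hG.commutator_pow k
  have happ : ∀ {x : ℝ → Hardy} {x' : Hardy}, HasDerivAt x x' t →
      HasDerivAt (fun τ => (G τ ^ k) (x τ))
        ((-Complex.I • (T * G t ^ k - G t ^ k * T)) (x t) + (G t ^ k) x') t := fun hx =>
    ((ContinuousLinearMap.restrictScalarsL ℂ Hardy Hardy ℝ ℝ).hasFDerivAt.comp_hasDerivAt t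
      hGk).clm_apply hx
  have hTs : ∀ x y, inner ℂ (T x) y = inner ℂ x (T y) := hT.isSymmetric
  have hGs' : ∀ x y, inner ℂ (G t x) y = inner ℂ x (G t y) := hGs.isSymmetric
  have h1 := (hU.inner ℂ (happ hU)).sub
    (((hasDerivAt_const t oneH).inner ℂ (happ (hasDerivAt_const t oneH))).const_mul (α : ℂ))
  refine h1.congr_deriv ?_
  have hcomm : (G t ^ k) (G t oneH) = G t ((G t ^ k) oneH) := by
    rw [← mul_apply_eq_comp, ← mul_apply_eq_comp, ← pow_succ, pow_succ']
  have h2 : inner ℂ oneH (T ((G t ^ k) oneH)) = inner ℂ oneH (G t ((G t ^ k) oneH)) +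
      c * inner ℂ (U t) ((G t ^ k) oneH) := by
    rw [← hTs, hT1, inner_add_left, hGs', inner_smul_left, conj_conj]
  simp only [smul_apply, sub_apply, mul_apply_eq_comp, inner_add_right,
    inner_add_left, inner_smul_left, inner_smul_right, inner_sub_right, map_add, map_smul, map_neg,
    map_mul, conj_I, hT1, hTs, h2, hcomm, smul_add, inner_zero_left, map_zero, inner_zero_right,
    conj_ofReal]
  ring

lemma lForm_aeval_eq {G : ℝ → Hardy →L[ℂ] Hardy} {U : ℝ → Hardy} {t₁ t₂ : ℝ}
    (h : ∀ k : ℕ, lForm α (U t₁) (G t₁ ^ k) = lForm α (U t₂) (G t₂ ^ k)) (P : Polynomial ℂ) :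
    lForm α (U t₁) (Polynomial.aeval (G t₁) P) = lForm α (U t₂) (Polynomial.aeval (G t₂) P) := by
  induction P using Polynomial.induction_on' with
  | add p q hp hq => simp only [map_add, lForm_add, hp, hq]
  | monomial n a =>
    simp only [Polynomial.aeval_monomial, ← Algebra.smul_def, lForm_smul, h]

end Conservation

instance : StarModule ℝ (Hardy →L[ℂ] Hardy) where
  star_smul r A := by
    have h : ∀ B : Hardy →L[ℂ] Hardy, r • B = (r : ℂ) • B := fun B => by
      ext1 x
      exact (Complex.coe_smul r (B x)).symm
    rw [star_trivial r, h, h, star_smul]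
    simp

lemma commutator_identity {R : Type*} [Ring R] [StarRing R] [Algebra ℂ R] [StarModule ℂ R]
    (L L' Γ : R) :
    (-Complex.I • (star L * L * Γ + Γ * (star L' * L') - Γ * star Γ * Γ)) * star Γ +
      Γ * star (-Complex.I • (star L * L * Γ + Γ * (star L' * L') - Γ * star Γ * Γ)) =
      -Complex.I • (star L * L * (Γ * star Γ) - Γ * star Γ * (star L * L)) := by
  rw [star_smul]
  simp only [star_sub, star_add, star_mul, star_star, smul_mul_assoc, mul_smul_comm, star_neg,
    RCLike.star_def, conj_I, neg_neg]
  rw [← neg_neg Complex.I, neg_smul (-Complex.I), neg_neg, ← sub_eq_add_neg, ← smul_sub]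
  congr 1
  noncomm_ring

lemma SolvesSzego.hasDerivAt_kOp {α : ℝ} {u : ℝ → ℕ → ℂ} (hsol : SolvesSzego α u) {s : ℝ}
    (hs : 1 / 2 < s) (hu : ∀ t, MemHs s (u t)) (t : ℝ) :
    HasDerivAt (fun τ => kOp (u τ))
      (-Complex.I • (opSum coshiftOp (star (u t)) * opSum shiftOp (u t) * kOp (u t) -
        kOp (u t) * (opSum coshiftOp (star (u t)) * opSum shiftOp (u t)))) t := by
  have hΓ := hsol.hasDerivAt_opSum hs hu norm_reflOp_le t
  rw [reflOp_zero, smul_zero, add_zero, opSum_reflOp_cubic (hsol.summable_norm hs hu t)] at hΓ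
  simp only [kOp, ← star_opSum_reflOp]
  refine (hΓ.mul hΓ.star).congr_deriv ?_
  have h := commutator_identity (opSum shiftOp (u t)) (opSum shiftOp (star (u t)))
    (opSum reflOp (u t))
  rw [star_opSum_shiftOp, star_opSum_shiftOp, star_star] at h
  rw [← star_opSum_reflOp (u t)]
  exact h

lemma SolvesSzego.hasDerivAt_opSum_shiftOp_oneH {α : ℝ} {u : ℝ → ℕ → ℂ}
    (hsol : SolvesSzego α u) {s : ℝ} (hs : 1 / 2 < s) (hu : ∀ t, MemHs s (u t)) (t : ℝ) :
    HasDerivAt (fun τ => opSum shiftOp (u τ) oneH)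
      (-Complex.I • ((opSum coshiftOp (star (u t)) * opSum shiftOp (u t))
        (opSum shiftOp (u t) oneH) + ((α : ℂ) * u t 0) • oneH)) t := by
  have h := ((ContinuousLinearMap.apply ℂ Hardy oneH).restrictScalars ℝ).hasFDerivAt.comp_hasDerivAt
    t (hsol.hasDerivAt_opSum hs hu norm_shiftOp_le t)
  refine h.congr_deriv ?_
  rw [← opSum_shiftOp_cubic (hsol.summable_norm hs hu t) (hsol.summable_norm_cubic hs hu t)]
  have h0 : shiftOp 0 oneH = oneH := by
    ext n
    simp [shiftOp_apply]
  change (-Complex.I • (opSum shiftOp (cubic (u t)) + ((α : ℂ) * u t 0) • shiftOp 0)) oneH = _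
  simp only [smul_apply, add_apply, h0]

lemma SolvesSzego.lForm_pow_eq {α : ℝ} {u : ℝ → ℕ → ℂ} (hsol : SolvesSzego α u) {s : ℝ}
    (hs : 1 / 2 < s) (hu : ∀ t, MemHs s (u t)) (k : ℕ) (t₁ t₂ : ℝ) :
    lForm α (opSum shiftOp (u t₁) oneH) (kOp (u t₁) ^ k) =
      lForm α (opSum shiftOp (u t₂) oneH) (kOp (u t₂) ^ k) := by
  have key : ∀ t, HasDerivAt
      (fun τ => lForm α (opSum shiftOp (u τ) oneH) (kOp (u τ) ^ k)) 0 t := by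
    intro t
    have hw := hsol.summable_norm hs hu t
    have hw' : Summable fun n => ‖(star (u t)) n‖ := by simpa using hw
    have hT : IsSelfAdjoint (opSum coshiftOp (star (u t)) * opSum shiftOp (u t)) := by
      rw [← star_opSum_shiftOp]
      exact .star_mul_self _
    refine hasDerivAt_lForm_pow (hsol.hasDerivAt_kOp hs hu t)
      (hsol.hasDerivAt_opSum_shiftOp_oneH hs hu t) hT (isSelfAdjoint_kOp _) ?_ k
    rw [coshift_mul_shift hw hw', add_apply, mul_apply_eq_comp, opSum_coshiftOp_oneH hw', map_smul,
      add_comm]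
    rfl
  exact is_const_of_deriv_eq_zero (fun t => (key t).differentiableAt) (fun t => (key t).deriv) t₁ t₂

section Ergodic

variable {H : Type*} [NormedAddCommGroup H] [InnerProductSpace ℂ H] [CompleteSpace H]

lemma norm_one_sub_sq_le_one {S : H →L[ℂ] H} (hS : IsSelfAdjoint S) (hS1 : ‖S‖ ≤ 1) :
    ‖1 - S ^ 2‖ ≤ 1 := by
  have hsym : ∀ x y, inner ℂ (S x) y = inner ℂ x (S y) := hS.isSymmetric
  refine ContinuousLinearMap.opNorm_le_bound _ zero_le_one fun x => ?_
  rw [one_mul, ← sq_le_sq₀ (norm_nonneg _) (norm_nonneg _)]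
  have h1 : (1 - S ^ 2 : H →L[ℂ] H) x = x - S (S x) := by
    rw [sub_apply, sq, mul_apply_eq_comp, one_apply_eq_self]
  have h2 : RCLike.re (inner ℂ x (S (S x))) = ‖S x‖ ^ 2 := by
    rw [← hsym, inner_self_eq_norm_sq]
  have h3 : ‖S (S x)‖ ≤ ‖S x‖ := by
    simpa using S.le_of_opNorm_le hS1 (S x)
  rw [h1, @norm_sub_sq ℂ, h2]
  nlinarith [norm_nonneg (S x), norm_nonneg (S (S x))]

lemma one_sub_sq_apply_eq_self_iff {S : H →L[ℂ] H} (hS : IsSelfAdjoint S) (x : H) :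
    (1 - S ^ 2 : H →L[ℂ] H) x = x ↔ S x = 0 := by
  have hsym : ∀ x y, inner ℂ (S x) y = inner ℂ x (S y) := hS.isSymmetric
  rw [sub_apply, sq, mul_apply_eq_comp, one_apply_eq_self, sub_eq_self]
  refine ⟨fun h => ?_, fun h => by rw [h, map_zero]⟩
  rw [← inner_self_eq_zero (𝕜 := ℂ), hsym, h, inner_zero_right]

lemma tendsto_inner_birkhoffAverage {S : H →L[ℂ] H} (hS : IsSelfAdjoint S) (hS1 : ‖S‖ ≤ 1)
    {x p : H} (hp : S p = 0) (hxp : ∀ v, S v = 0 → inner ℂ v (x - p) = 0) :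
    Tendsto (fun N => inner ℂ x (birkhoffAverage ℂ (1 - S ^ 2 : H →L[ℂ] H) id N x)) atTop
      (𝓝 (((‖p‖ ^ 2 : ℝ) : ℂ))) := by
  have h := (1 - S ^ 2 : H →L[ℂ] H).tendsto_birkhoffAverage_orthogonalProjection
    (norm_one_sub_sq_le_one hS hS1) x
  have hmem : ∀ v, v ∈ ((1 - S ^ 2 : H →L[ℂ] H) : H →ₗ[ℂ] H).eqLocus
      ((1 : H →L[ℂ] H) : H →ₗ[ℂ] H) ↔ S v = 0 := fun v => by
    rw [← one_sub_sq_apply_eq_self_iff hS]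
    rfl
  have hproj : p = ((((1 - S ^ 2 : H →L[ℂ] H) : H →ₗ[ℂ] H).eqLocus
      ((1 : H →L[ℂ] H) : H →ₗ[ℂ] H)).orthogonalProjectionOnto x : H) :=
    (Submodule.eq_starProjection_of_mem_of_inner_eq_zero ((hmem p).2 hp)
      fun v hv => inner_eq_zero_symm.1 (hxp v ((hmem v).1 hv))).symm
  rw [← hproj] at h
  have hpp : inner ℂ x p = ((‖p‖ ^ 2 : ℝ) : ℂ) := by
    have h0 := inner_eq_zero_symm.1 (hxp p hp)
    rw [inner_sub_left, sub_eq_zero] at h0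
    rw [h0, inner_self_eq_norm_sq_to_K]
    simp
  rw [← hpp]
  exact tendsto_const_nhds.inner h

end Ergodic

lemma hinner_eq_inner (x y : Hardy) : hinner x y = inner ℂ y x := by
  rw [lp.inner_eq_tsum, hinner]
  rfl

lemma l2normSq_eq (x : Hardy) : l2normSq x = ‖x‖ ^ 2 := by
  simpa [l2normSq] using (lp.norm_rpow_eq_tsum (p := 2) (by norm_num) x).symm

lemma mem_Fspace_iff {w : ℕ → ℂ} (hw : Summable fun n => ‖w n‖) (σ : ℝ) (x : Hardy) :
    (x : ℕ → ℂ) ∈ Fspace w σ ↔ (kOp w - ((σ : ℂ) ^ 2) • 1) x = 0 := by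
  rw [sub_apply, sub_eq_zero, Fspace, Set.mem_ofPred_eq, ku2_coe hw, smul_apply, one_apply_eq_self]
  refine ⟨fun h => Subtype.ext h.2, fun h => ⟨lp.memℓp x, ?_⟩⟩
  rw [h]
  rfl

/-- The operator `r (K_w² - σ²)`. -/
def shiftedKOp (r σ : ℝ) (w : ℕ → ℂ) : Hardy →L[ℂ] Hardy :=
  (r : ℂ) • (kOp w - ((σ : ℂ) ^ 2) • 1)

lemma isSelfAdjoint_shiftedKOp (r σ : ℝ) (w : ℕ → ℂ) : IsSelfAdjoint (shiftedKOp r σ w) := by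
  have h : IsSelfAdjoint (((σ : ℂ) ^ 2) • (1 : Hardy →L[ℂ] Hardy)) :=
    .smul (by simp [IsSelfAdjoint]) (.one _)
  exact .smul (by simp [IsSelfAdjoint]) ((isSelfAdjoint_kOp w).sub h)

lemma IsOrthProj.tendsto_inner_birkhoffAverage {w : ℕ → ℂ} (hw : Summable fun n => ‖w n‖)
    {r σ : ℝ} (hr : r ≠ 0) (hr1 : ‖shiftedKOp r σ w‖ ≤ 1) {x : Hardy} {p : ℕ → ℂ}
    (hp : IsOrthProj (Fspace w σ) x p) :
    Tendsto (fun N => inner ℂ x (birkhoffAverage ℂ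
      (1 - shiftedKOp r σ w ^ 2 : Hardy →L[ℂ] Hardy) id N x)) atTop (𝓝 ((l2normSq p : ℝ) : ℂ)) := by
  obtain ⟨p, rfl⟩ : ∃ y : Hardy, (y : ℕ → ℂ) = p := ⟨⟨p, hp.1.1⟩, rfl⟩
  have hmem : ∀ y : Hardy, (y : ℕ → ℂ) ∈ Fspace w σ ↔ shiftedKOp r σ w y = 0 := fun y => by
    rw [mem_Fspace_iff hw, shiftedKOp, smul_apply, smul_eq_zero_iff_right (by exact_mod_cast hr)]
  rw [l2normSq_eq]
  refine _root_.tendsto_inner_birkhoffAverage (isSelfAdjoint_shiftedKOp r σ w) hr1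
    ((hmem p).1 hp.1) fun v hv => ?_
  rw [← hinner_eq_inner]
  exact hp.2 v ((hmem v).2 hv)

lemma lForm_birkhoffAverage (α : ℝ) (U : Hardy) (B : Hardy →L[ℂ] Hardy) (N : ℕ) :
    inner ℂ U (birkhoffAverage ℂ B id N U) - α * inner ℂ oneH (birkhoffAverage ℂ B id N oneH) =
      (N : ℂ)⁻¹ * ∑ k ∈ Finset.range N, lForm α U (B ^ k) := by
  simp only [birkhoffAverage, birkhoffSum, inner_smul_right, inner_sum, lForm, id,
    FunLike.coe_pow_eq_iterate, Finset.sum_sub_distrib, ← Finset.mul_sum]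
  ring

lemma exists_norm_shiftedKOp_le (σ : ℝ) (w w' : ℕ → ℂ) :
    ∃ r : ℝ, r ≠ 0 ∧ ‖shiftedKOp r σ w‖ ≤ 1 ∧ ‖shiftedKOp r σ w'‖ ≤ 1 := by
  set R := 1 + ‖shiftedKOp 1 σ w‖ + ‖shiftedKOp 1 σ w'‖
  have hR : 0 < R := by positivity
  have h : ∀ v, ‖shiftedKOp R⁻¹ σ v‖ = R⁻¹ * ‖shiftedKOp 1 σ v‖ := fun v => by
    simp [shiftedKOp, norm_smul, abs_of_pos hR]
  refine ⟨R⁻¹, inv_ne_zero hR.ne', ?_, ?_⟩ <;> rw [h, inv_mul_le_iff₀ hR, mul_one] <;>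
    linarith [norm_nonneg (shiftedKOp 1 σ w), norm_nonneg (shiftedKOp 1 σ w')]

lemma one_sub_shiftedKOp_sq_pow_eq_aeval (r σ : ℝ) (w : ℕ → ℂ) (k : ℕ) :
    (1 - shiftedKOp r σ w ^ 2) ^ k = Polynomial.aeval (kOp w)
      ((1 - (Polynomial.C (r : ℂ) * (Polynomial.X - Polynomial.C ((σ : ℂ) ^ 2))) ^ 2) ^ k) := by
  rw [map_pow, map_sub, map_pow, map_mul, map_sub, Polynomial.aeval_C, Polynomial.aeval_C,
    Polynomial.aeval_X, map_one, ← Algebra.smul_def, Algebra.algebraMap_eq_smul_one]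
  rfl

lemma SolvesSzego.lForm_one_sub_sq_pow_eq {α : ℝ} {u : ℝ → ℕ → ℂ} (hsol : SolvesSzego α u)
    {s : ℝ} (hs : 1 / 2 < s) (hu : ∀ t, MemHs s (u t)) (r σ : ℝ) (k : ℕ) (t₁ t₂ : ℝ) :
    lForm α (opSum shiftOp (u t₁) oneH) ((1 - shiftedKOp r σ (u t₁) ^ 2) ^ k) =
      lForm α (opSum shiftOp (u t₂) oneH) ((1 - shiftedKOp r σ (u t₂) ^ 2) ^ k) := by
  rw [one_sub_shiftedKOp_sq_pow_eq_aeval, one_sub_shiftedKOp_sq_pow_eq_aeval]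
  exact lForm_aeval_eq (G := fun t => kOp (u t)) (U := fun t => opSum shiftOp (u t) oneH)
    (fun k => hsol.lForm_pow_eq hs hu k t₁ t₂) _

/-- For `σ > 0`, the quantity `ℓ_σ = ‖u'_σ‖² − α ‖v'_σ‖²`, where
`u'_σ(t)`, `v'_σ(t)` are the orthogonal projections of `u(t)` and of `1` onto
`F_{u(t)}(σ) = ker(K_{u(t)}² − σ² I)`, is conserved by the α-Szegő flow. -/
theorem alphaSzego_conservation_ell (α s σ : ℝ) (hs : 1/2 < s) (hσ : 0 < σ)
    (u : ℝ → ℕ → ℂ) (hreg : SmoothHsCurve s u) (hsol : SolvesSzego α u)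
    (p q : ℝ → ℕ → ℂ)
    (hp : ∀ t, IsOrthProj (Fspace (u t) σ) (u t) (p t))
    (hq : ∀ t, IsOrthProj (Fspace (u t) σ) oneSeq (q t)) :
    ∀ t₁ t₂ : ℝ,
      l2normSq (p t₁) - α * l2normSq (q t₁) = l2normSq (p t₂) - α * l2normSq (q t₂) := by
  intro t₁ t₂
  obtain ⟨r, hr, hr₁, hr₂⟩ := exists_norm_shiftedKOp_le σ (u t₁) (u t₂)
  have hlim : ∀ t, ‖shiftedKOp r σ (u t)‖ ≤ 1 →
      Tendsto (fun N : ℕ => (N : ℂ)⁻¹ * ∑ k ∈ Finset.range N,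
        lForm α (opSum shiftOp (u t) oneH) ((1 - shiftedKOp r σ (u t) ^ 2) ^ k)) atTop
        (𝓝 (l2normSq (p t) - α * l2normSq (q t))) := by
    intro t ht
    have hw := hsol.summable_norm hs hreg.1 t
    have hU : u t = (opSum shiftOp (u t) oneH : ℕ → ℂ) :=
      funext fun k => (opSum_shiftOp_oneH_apply hw k).symm
    have h1 : oneSeq = (oneH : ℕ → ℂ) := funext fun k => (coe_oneH k).symm
    have hp' : IsOrthProj (Fspace (u t) σ) (opSum shiftOp (u t) oneH : Hardy) (p t) := hU ▸ hp t
    have hq' : IsOrthProj (Fspace (u t) σ) (oneH : Hardy) (q t) := h1 ▸ hq t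
    simp_rw [← lForm_birkhoffAverage]
    exact (hp'.tendsto_inner_birkhoffAverage hw hr ht).sub
      ((hq'.tendsto_inner_birkhoffAverage hw hr ht).const_mul _)
  have h₁ := hlim t₁ hr₁
  simp_rw [hsol.lForm_one_sub_sq_pow_eq hs hreg.1 r σ _ t₁ t₂] at h₁
  exact_mod_cast tendsto_nhds_unique h₁ (hlim t₂ hr₂)

end
end

section
/- Let u ∈ H^{1/2}₊(S¹) be such that H_u has finite rank, and suppose Σ_H(u) = {ρ_1, …, ρ_N} and Σ_K(u) = {σ_1, …, σ_N} with the interlacing ρ_1 > σ_1 > ρ_2 > σ_2 > ⋯ > ρ_N > σ_N ≥ 0. Let u_j be the orthogonal projection of u onto E_u(ρ_j) and u'_k the orthogonal projection of u onto F_u(σ_k). Then for each j and k: ‖u_j‖² = ∏_{ℓ=1}^N (ρ_j² − σ_ℓ²) / ∏_{ℓ≠j} (ρ_j² − ρ_ℓ²) and ‖u'_k‖² = ∏_{ℓ=1}^N (ρ_ℓ² − σ_k²) / ∏_{ℓ≠k} (σ_ℓ² − σ_k²), where ‖·‖ is the L² norm. -/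
open Complex Filter
open scoped ComplexConjugate Topology ENNReal

noncomputable section

section Hankel

variable {u : ℕ → ℂ}

theorem summable_norm_sq (h : Hardy) : Summable fun n => ‖h n‖ ^ 2 := by
  have := (lp.memℓp h).summable (by norm_num)
  simpa using this

theorem memL2_iff_summable {f : ℕ → ℂ} : MemL2 f ↔ Summable fun n => ‖f n‖ ^ 2 := by
  unfold MemL2
  rw [memℓp_gen_iff (by norm_num)]
  simp

theorem MemHs.summable_succ_mul (hu : MemHs (1 / 2) u) :
    Summable fun n : ℕ => ((n : ℝ) + 1) * ‖u n‖ ^ 2 := by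
  have h2 : Summable fun n : ℕ => 2 * (((1 : ℝ) + (n : ℝ) ^ 2) ^ (1 / 2 : ℝ) * ‖u n‖ ^ 2) :=
    Summable.mul_left 2 hu
  refine Summable.of_nonneg_of_le (fun n => by positivity) (fun n => ?_) h2
  rw [← mul_assoc]
  refine mul_le_mul_of_nonneg_right ?_ (by positivity)
  rw [← Real.sqrt_eq_rpow]
  have h3 : ((n : ℝ) + 1) / 2 ≤ √(1 + (n : ℝ) ^ 2) :=
    Real.le_sqrt_of_sq_le (by nlinarith [sq_nonneg ((n : ℝ) - 1)])
  linarith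

/-- The matrix of the Hankel operator is square summable. -/
theorem summable_hankel_matrix (hu : Summable fun n : ℕ => ((n : ℝ) + 1) * ‖u n‖ ^ 2) :
    Summable fun q : ℕ × ℕ => ‖u (q.1 + q.2)‖ ^ 2 := by
  rw [← Finset.HasAntidiagonal.sigmaAntidiagonalEquivProd.summable_iff, summable_sigma_of_nonneg]
  · refine ⟨fun n => Summable.of_finite, ?_⟩
    refine hu.congr fun n => ?_
    rw [tsum_fintype, Finset.sum_congr rfl fun x _ => show _ = ‖u n‖ ^ 2 from ?_]
    · simp
    · exact congrArg (‖u ·‖ ^ 2) (Finset.HasAntidiagonal.mem_antidiagonal.mp x.2)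
  · exact fun x => sq_nonneg _

/-- The `k`-th row of the Hankel matrix, as an element of ℓ². -/
def hankelRow (hu : Summable fun n : ℕ => ((n : ℝ) + 1) * ‖u n‖ ^ 2) (k : ℕ) : Hardy :=
  ⟨fun l => u (k + l), memL2_iff_summable.mpr ((summable_hankel_matrix hu).prod_factor k)⟩

theorem norm_sq_eq_tsum (f : Hardy) : ‖f‖ ^ 2 = ∑' n, ‖f n‖ ^ 2 := by
  have := lp.norm_rpow_eq_tsum (p := 2) (by norm_num) f
  simpa using this

theorem hankel_eq_inner (hu : Summable fun n : ℕ => ((n : ℝ) + 1) * ‖u n‖ ^ 2) (h : Hardy)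
    (k : ℕ) : hankel u h k = inner ℂ h (hankelRow hu k) := by
  rw [lp.inner_eq_tsum]
  rfl

theorem memL2_hankel (hu : Summable fun n : ℕ => ((n : ℝ) + 1) * ‖u n‖ ^ 2) (h : Hardy) :
    MemL2 (hankel u h) := by
  rw [memL2_iff_summable]
  have hrow : Summable fun k => ‖h‖ ^ 2 * ‖hankelRow hu k‖ ^ 2 := by
    refine Summable.mul_left _ ((summable_hankel_matrix hu).prod.congr fun k => ?_)
    rw [norm_sq_eq_tsum]
    rfl
  refine Summable.of_nonneg_of_le (fun k => by positivity) (fun k => ?_) hrow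
  rw [hankel_eq_inner hu, ← mul_pow]
  exact pow_le_pow_left₀ (norm_nonneg _) (norm_inner_le_norm _ _) 2

/-- The Hankel operator as a conjugate-linear map of the Hardy space. -/
def hankelOp (hu : Summable fun n : ℕ => ((n : ℝ) + 1) * ‖u n‖ ^ 2) :
    Hardy →ₛₗ[starRingEnd ℂ] Hardy where
  toFun h := ⟨hankel u h, memL2_hankel hu h⟩
  map_add' f g := by
    ext k
    change hankel u (f + g : Hardy) k = hankel u f k + hankel u g k
    simp only [hankel_eq_inner hu, inner_add_left]
  map_smul' c f := by
    ext k
    change hankel u (c • f : Hardy) k = conj c * hankel u f k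
    simp only [hankel_eq_inner hu, inner_smul_left]

theorem hankelOp_coe (hu : Summable fun n : ℕ => ((n : ℝ) + 1) * ‖u n‖ ^ 2) (h : Hardy) :
    (hankelOp hu h : ℕ → ℂ) = hankel u h := rfl

theorem inner_hankelOp_comm (hu : Summable fun n : ℕ => ((n : ℝ) + 1) * ‖u n‖ ^ 2)
    (f g : Hardy) : inner ℂ f (hankelOp hu g) = inner ℂ g (hankelOp hu f) := by
  have hs : Summable fun q : ℕ × ℕ => u (q.1 + q.2) * conj (g q.2) * conj (f q.1) := by
    have hfg := (summable_norm_sq f).mul_of_nonneg (summable_norm_sq g)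
      (fun _ => by positivity) (fun _ => by positivity)
    refine Summable.of_norm_bounded ((summable_hankel_matrix hu).add hfg) fun q => ?_
    simp only [norm_mul, RCLike.norm_conj]
    nlinarith [sq_nonneg (‖u (q.1 + q.2)‖ - ‖f q.1‖ * ‖g q.2‖),
      sq_nonneg ‖u (q.1 + q.2)‖, sq_nonneg (‖f q.1‖ * ‖g q.2‖)]
  have hcomm := hs.tsum_comm (f := fun k l => u (k + l) * conj (g l) * conj (f k))
  have key : ∀ x y : Hardy, inner ℂ x (hankelOp hu y) =
      ∑' k, ∑' l, u (k + l) * conj (y l) * conj (x k) := by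
    intro x y
    rw [lp.inner_eq_tsum]
    refine tsum_congr fun k => ?_
    rw [tsum_mul_right]
    rfl
  rw [key, key, ← hcomm]
  refine tsum_congr fun l => tsum_congr fun k => ?_
  rw [add_comm k l]
  ring

/-- The square of the Hankel operator, as a linear map of the Hardy space. -/
def hankelSq (hu : Summable fun n : ℕ => ((n : ℝ) + 1) * ‖u n‖ ^ 2) : Hardy →ₗ[ℂ] Hardy :=
  (hankelOp hu).comp (hankelOp hu)

theorem inner_hankelSq_right (hu : Summable fun n : ℕ => ((n : ℝ) + 1) * ‖u n‖ ^ 2)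
    (f g : Hardy) : inner ℂ f (hankelSq hu g) = inner ℂ (hankelOp hu g) (hankelOp hu f) :=
  inner_hankelOp_comm hu _ _

theorem hankelSq_isPositive (hu : Summable fun n : ℕ => ((n : ℝ) + 1) * ‖u n‖ ^ 2) :
    (hankelSq hu).IsPositive := by
  have hsymm : (hankelSq hu).IsSymmetric := fun f g => by
    rw [inner_hankelSq_right, ← inner_conj_symm, inner_hankelSq_right, inner_conj_symm]
  refine ⟨hsymm, fun f => ?_⟩
  rw [hsymm, inner_hankelSq_right]
  exact inner_self_nonneg

theorem khankel_eq_hankel_shift (u h : ℕ → ℂ) :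
    khankel u h = hankel (fun n => u (n + 1)) h := by
  funext k
  unfold khankel hankel
  simp only [add_right_comm]

theorem ku2_eq_hu2_shift (u h : ℕ → ℂ) : ku2 u h = hu2 (fun n => u (n + 1)) h := by
  simp only [ku2, hu2, khankel_eq_hankel_shift]

theorem summable_succ_mul_shift (hu : Summable fun n : ℕ => ((n : ℝ) + 1) * ‖u n‖ ^ 2) :
    Summable fun n : ℕ => ((n : ℝ) + 1) * ‖u (n + 1)‖ ^ 2 := by
  refine Summable.of_nonneg_of_le (fun n => by positivity) (fun n => ?_)
    ((summable_nat_add_iff 1).mpr hu)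
  push_cast
  exact mul_le_mul_of_nonneg_right (by linarith) (by positivity)

/-- `K_u² = H_u² - (· | u) u`. -/
theorem hankelSq_shift (hu : Summable fun n : ℕ => ((n : ℝ) + 1) * ‖u n‖ ^ 2) (h : Hardy) :
    hankelSq (summable_succ_mul_shift hu) h =
      hankelSq hu h - (inner ℂ (hankelRow hu 0) h) • hankelRow hu 0 := by
  ext k
  change hu2 (fun n => u (n + 1)) h k =
    hu2 u h k - inner ℂ (hankelRow hu 0) h * u (0 + k)
  have hs : Summable fun l => u (k + l) * conj (hankel u h l) :=
    lp.summable_inner (hankelOp hu h) (hankelRow hu k)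
  have hsplit := hs.sum_add_tsum_nat_add 1
  have h0 : conj (hankel u h 0) = inner ℂ (hankelRow hu 0) h := by
    rw [hankel_eq_inner hu, inner_conj_symm]
  simp only [Finset.sum_range_one, h0] at hsplit
  have hK : hu2 (fun n => u (n + 1)) h k =
      ∑' l, u (k + (l + 1)) * conj (hankel u h (l + 1)) := by
    unfold hu2
    conv_lhs => unfold hankel
    refine tsum_congr fun l => ?_
    simp only [hankel, add_assoc, add_comm, add_left_comm]
  rw [hK]
  have hH : hu2 u h k = ∑' l, u (k + l) * conj (hankel u h l) := rfl
  rw [hH, ← hsplit]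
  simp only [add_zero, zero_add]
  ring

theorem inner_hankelRow_zero_eq_zero (hu : Summable fun n : ℕ => ((n : ℝ) + 1) * ‖u n‖ ^ 2)
    {h : Hardy} (hh : hankelSq hu h = 0) : inner ℂ h (hankelRow hu 0) = 0 := by
  have h0 : hankelOp hu h = 0 := by
    rw [← inner_self_eq_zero (𝕜 := ℂ), ← inner_hankelSq_right, hh, inner_zero_right]
  rw [← hankel_eq_inner hu, ← hankelOp_coe hu, h0]
  rfl

theorem finiteDimensional_range_hankelSq
    (hu : Summable fun n : ℕ => ((n : ℝ) + 1) * ‖u n‖ ^ 2)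
    (hfin : huRank u < Cardinal.aleph0) :
    FiniteDimensional ℂ (LinearMap.range (hankelSq hu)) := by
  let V := Submodule.span ℂ (hankel u '' {h | MemL2 h})
  have : FiniteDimensional ℂ V := Module.rank_lt_aleph0_iff.mp hfin
  let f : LinearMap.range (hankelSq hu) →ₗ[ℂ] V :=
    { toFun := fun x => ⟨(x : Hardy), by
        obtain ⟨y, hy⟩ := x.2
        rw [← hy]
        exact Submodule.subset_span ⟨hankelOp hu y, lp.memℓp _, rfl⟩⟩
      map_add' := fun _ _ => rfl
      map_smul' := fun _ _ => rfl }
  refine FiniteDimensional.of_injective f fun x y hxy => ?_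
  exact Subtype.ext (Subtype.ext (congrArg (fun z : V => (z : ℕ → ℂ)) hxy))

theorem finiteDimensional_range_hankelSq_shift
    (hu : Summable fun n : ℕ => ((n : ℝ) + 1) * ‖u n‖ ^ 2)
    (hfin : huRank u < Cardinal.aleph0) :
    FiniteDimensional ℂ (LinearMap.range (hankelSq (summable_succ_mul_shift hu))) := by
  have := finiteDimensional_range_hankelSq hu hfin
  refine Submodule.finiteDimensional_of_le
    (S₂ := LinearMap.range (hankelSq hu) ⊔ Submodule.span ℂ {hankelRow hu 0}) ?_
  rintro _ ⟨h, rfl⟩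
  rw [hankelSq_shift hu]
  exact Submodule.sub_mem _ (Submodule.mem_sup_left ⟨h, rfl⟩)
    (Submodule.mem_sup_right (Submodule.smul_mem _ _ (Submodule.mem_span_singleton_self _)))

end Hankel

section Spectral

variable {E : Type*} [NormedAddCommGroup E] [InnerProductSpace ℂ E] {T : E →ₗ[ℂ] E}

/-- A vector orthogonal to all eigenvectors of a finite-rank symmetric operator vanishes. -/
theorem LinearMap.IsSymmetric.eq_zero_of_inner_eigenvector_eq_zero (hT : T.IsSymmetric)
    [FiniteDimensional ℂ (LinearMap.range T)] {w : E}
    (hw : ∀ (μ : ℂ) (v : E), T v = μ • v → inner ℂ v w = 0) : w = 0 := by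
  have hinv : ∀ v ∈ LinearMap.range T, T v ∈ LinearMap.range T := fun v _ => ⟨v, rfl⟩
  have hbot := (hT.restrict_invariant hinv).orthogonalComplement_iSup_eigenspaces_eq_bot
  have hTw : T w = 0 := by
    have hmem : (⟨T w, w, rfl⟩ : LinearMap.range T) ∈
        (⨆ μ : ℂ, Module.End.eigenspace (T.restrict hinv) μ)ᗮ := by
      rw [← Submodule.iInf_orthogonal, Submodule.mem_iInf]
      intro μ
      rw [Submodule.mem_orthogonal]
      intro v hv
      have hv' : T v = μ • (v : E) :=
        congrArg Subtype.val (Module.End.mem_eigenspace_iff.mp hv)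
      change inner ℂ (v : E) (T w) = 0
      rw [← hT, hv', inner_smul_left, hw μ v hv', mul_zero]
    rw [hbot, Submodule.mem_bot] at hmem
    exact congrArg Subtype.val hmem
  exact inner_self_eq_zero.mp (hw 0 w (by rw [hTw, zero_smul]))

theorem LinearMap.IsSymmetric.inner_eq_zero_of_ne (hT : T.IsSymmetric) {a : ℝ} {b : ℂ}
    {v w : E} (hv : T v = b • v) (hw : T w = (a : ℂ) • w) (hab : b ≠ a) : inner ℂ v w = 0 := by
  have h := hT w v
  rw [hv, hw, inner_smul_left, inner_smul_right, Complex.conj_ofReal] at h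
  rw [inner_eq_zero_symm]
  have h' : (b - a) * inner ℂ w v = 0 := by linear_combination -h
  exact (mul_eq_zero.mp h').resolve_left (sub_ne_zero.mpr hab)

theorem LinearMap.IsPositive.exists_eq_sq_of_eigenvector (hT : T.IsPositive) {μ : ℂ} {v : E}
    (hv : T v = μ • v) (hv0 : v ≠ 0) : ∃ τ : ℝ, 0 ≤ τ ∧ μ = (τ : ℂ) ^ 2 := by
  have hn : 0 < ‖v‖ ^ 2 := by positivity
  have hμ : conj μ = μ :=
    hT.1.conj_eigenvalue_eq_self (Module.End.hasEigenvalue_of_hasEigenvector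
      ⟨Module.End.mem_eigenspace_iff.mpr hv, hv0⟩)
  have hpos := hT.2 v
  obtain ⟨r, rfl⟩ := Complex.conj_eq_iff_real.mp hμ
  rw [hv, inner_smul_left, inner_self_eq_norm_sq_to_K, Complex.conj_ofReal] at hpos
  have hr : 0 ≤ r * ‖v‖ ^ 2 := by
    rw [← Complex.ofReal_re (r * ‖v‖ ^ 2), Complex.ofReal_mul, Complex.ofReal_pow]
    exact hpos
  refine ⟨√r, Real.sqrt_nonneg r, ?_⟩
  rw [← Complex.ofReal_pow, Real.sq_sqrt (nonneg_of_mul_nonneg_left hr hn)]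

/-- Spectral decomposition of a vector along the eigenspaces not orthogonal to it. -/
theorem LinearMap.IsSymmetric.eq_sum_of_orthogonal_projections {ι : Type*} [Fintype ι]
    (hT : T.IsSymmetric) [FiniteDimensional ℂ (LinearMap.range T)] {x : E} {c : ι → ℝ}
    (hc : Function.Injective c) {p : ι → E} (hp : ∀ i, T (p i) = (c i : ℂ) • p i)
    (hproj : ∀ i v, T v = (c i : ℂ) • v → inner ℂ v (x - p i) = 0)
    (hx : ∀ (μ : ℂ) (v : E), T v = μ • v → (∀ i, μ ≠ c i) → inner ℂ v x = 0) :
    x = ∑ i, p i := by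
  classical
  rw [← sub_eq_zero]
  refine hT.eq_zero_of_inner_eigenvector_eq_zero fun μ v hv => ?_
  rw [inner_sub_right, inner_sum]
  by_cases hμ : ∃ i, μ = c i
  · obtain ⟨i, rfl⟩ := hμ
    rw [Finset.sum_eq_single i, ← inner_sub_right, hproj i v hv]
    · intro j _ hji
      refine hT.inner_eq_zero_of_ne hv (hp j) fun h => hji ?_
      exact (hc (Complex.ofReal_injective h)).symm
    · simp
  · push Not at hμ
    rw [hx μ v hv hμ, Finset.sum_eq_zero, sub_zero]
    exact fun i _ => hT.inner_eq_zero_of_ne hv (hp i) (hμ i)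

end Spectral

/-- Inversion of a Cauchy system with constant right-hand side. -/
theorem eq_prod_div_prod_of_sum_div_eq_one {ι K : Type*} [Fintype ι] [DecidableEq ι] [Field K]
    {x y a : ι → K} (hx : Function.Injective x) (hy : Function.Injective y)
    (hxy : ∀ j k, x j ≠ y k) (h : ∀ k, ∑ j, a j / (x j - y k) = 1) (j : ι) :
    a j = (∏ l, (x j - y l)) / ∏ l ∈ Finset.univ.erase j, (x j - x l) := by
  open Polynomial in
  let P : K[X] := ∏ i, (X - C (x i))
  let Q : K[X] := ∏ i, (X - C (y i))
  let R : K[X] := ∑ j, C (a j) * ∏ i ∈ Finset.univ.erase j, (X - C (x i))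
  have hR : ∀ t, R.eval t = ∑ j, a j * ∏ i ∈ Finset.univ.erase j, (t - x i) := by
    intro t
    simp [R, Polynomial.eval_finsetSum, Polynomial.eval_prod]
  have hlt : (P + R - Q).degree < Fintype.card ι := by
    have : Nonempty ι := ⟨j⟩
    have hPQ : (P - Q).degree < Fintype.card ι := by
      have hPd : P.degree = Fintype.card ι := by simp [P, Polynomial.degree_prod]
      have hQd : Q.degree = Fintype.card ι := by simp [Q, Polynomial.degree_prod]
      rw [← hPd]
      refine Polynomial.degree_sub_lt_left (hPd.trans hQd.symm) ?_ ?_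
      · exact (Polynomial.monic_prod_of_monic _ _ fun i _ => Polynomial.monic_X_sub_C _).ne_zero
      · rw [(Polynomial.monic_prod_of_monic _ _ fun i _ => Polynomial.monic_X_sub_C (x i)),
          (Polynomial.monic_prod_of_monic _ _ fun i _ => Polynomial.monic_X_sub_C (y i))]
    have hRd : R.degree < Fintype.card ι := by
      refine (Polynomial.degree_sum_le _ _).trans_lt ?_
      rw [Finset.sup_lt_iff (by exact WithBot.bot_lt_coe _)]
      intro i _
      rw [Polynomial.degree_mul, Polynomial.degree_prod]
      refine (add_le_add_left Polynomial.degree_C_le _).trans_lt ?_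
      simp only [Polynomial.degree_X_sub_C, Finset.sum_const, Finset.card_erase_of_mem
        (Finset.mem_univ i), Finset.card_univ, nsmul_eq_mul, mul_one, zero_add]
      exact_mod_cast Nat.sub_lt Fintype.card_pos one_pos
    rw [show P + R - Q = (P - Q) + R by ring]
    exact (Polynomial.degree_add_le _ _).trans_lt (max_lt hPQ hRd)
  have hzero : P + R - Q = 0 := by
    refine Polynomial.eq_zero_of_degree_lt_of_eval_index_eq_zero Finset.univ (v := y)
      hy.injOn (by simpa using hlt) fun k _ => ?_
    have hQk : Q.eval (y k) = 0 := by
      rw [Polynomial.eval_prod]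
      exact Finset.prod_eq_zero (Finset.mem_univ k) (by simp)
    have hPk : P.eval (y k) = ∏ i, (y k - x i) := by simp [P, Polynomial.eval_prod]
    have hRk : R.eval (y k) = -∏ i, (y k - x i) := by
      rw [hR, ← mul_one (∏ i, (y k - x i)), ← h k, Finset.mul_sum, ← Finset.sum_neg_distrib]
      refine Finset.sum_congr rfl fun i _ => ?_
      rw [← Finset.mul_prod_erase _ _ (Finset.mem_univ i)]
      have := sub_ne_zero.mpr (hxy i k)
      field_simp
      ring
    rw [Polynomial.eval_sub, Polynomial.eval_add, hQk, hPk, hRk]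
    ring
  have hev := congrArg (Polynomial.eval (x j)) hzero
  have hPj : P.eval (x j) = 0 := by
    rw [Polynomial.eval_prod]
    exact Finset.prod_eq_zero (Finset.mem_univ j) (by simp)
  have hQj : Q.eval (x j) = ∏ l, (x j - y l) := by simp [Q, Polynomial.eval_prod]
  have hRj : R.eval (x j) = a j * ∏ i ∈ Finset.univ.erase j, (x j - x i) := by
    rw [hR, Finset.sum_eq_single j]
    · intro i _ hij
      rw [Finset.prod_eq_zero (i := j), mul_zero]
      · exact Finset.mem_erase.mpr ⟨hij.symm, Finset.mem_univ j⟩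
      · exact sub_self _
    · simp
  rw [Polynomial.eval_sub, Polynomial.eval_add, hPj, hQj, hRj, Polynomial.eval_zero] at hev
  have hne : ∏ l ∈ Finset.univ.erase j, (x j - x l) ≠ 0 :=
    Finset.prod_ne_zero_iff.mpr fun l hl =>
      sub_ne_zero.mpr (hx.ne (Finset.ne_of_mem_erase hl).symm)
  rw [eq_div_iff hne]
  linear_combination hev

/-- Norms of the spectral projections of `x` for a symmetric operator `A` and its rank-one
perturbation `A - ⟪x, ·⟫ x`. -/
theorem norm_sq_of_rank_one_perturbation {ι E : Type*} [Fintype ι] [DecidableEq ι]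
    [NormedAddCommGroup E] [InnerProductSpace ℂ E] {A B : E →ₗ[ℂ] E} (hA : A.IsSymmetric)
    {x : E} (hAB : ∀ h, B h = A h - inner ℂ x h • x) {a b : ι → ℝ}
    (ha : Function.Injective a) (hb : Function.Injective b) (hab : ∀ j k, a j ≠ b k)
    {p q : ι → E} (hp : ∀ j, A (p j) = (a j : ℂ) • p j) (hq : ∀ k, B (q k) = (b k : ℂ) • q k)
    (hp0 : ∀ j, p j ≠ 0) (hq0 : ∀ k, q k ≠ 0)
    (hpx : ∀ j, inner ℂ (p j) x = (‖p j‖ : ℂ) ^ 2) (hqx : ∀ k, inner ℂ (q k) x = (‖q k‖ : ℂ) ^ 2)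
    (hxp : x = ∑ j, p j) (hxq : x = ∑ k, q k) :
    (∀ j, ‖p j‖ ^ 2 = (∏ l, (a j - b l)) / ∏ l ∈ Finset.univ.erase j, (a j - a l)) ∧
    (∀ k, ‖q k‖ ^ 2 = (∏ l, (a l - b k)) / ∏ l ∈ Finset.univ.erase k, (b l - b k)) := by
  have hne : ∀ j k, (a j : ℂ) - b k ≠ 0 := fun j k =>
    sub_ne_zero.mpr fun h => hab j k (Complex.ofReal_injective h)
  have key : ∀ j k, inner ℂ (p j) (q k) = (‖p j‖ : ℂ) ^ 2 * (‖q k‖ : ℂ) ^ 2 / (a j - b k) := by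
    intro j k
    have h := congrArg (inner ℂ (p j)) (hAB (q k))
    have hxq' : inner ℂ x (q k) = (‖q k‖ : ℂ) ^ 2 := by
      rw [← inner_conj_symm, hqx]
      simp
    rw [hq, inner_sub_right, ← hA, hp, inner_smul_left, inner_smul_right, inner_smul_right,
      hpx, hxq', Complex.conj_ofReal] at h
    rw [eq_div_iff (hne j k)]
    linear_combination -h
  have hpn : ∀ j, (‖p j‖ : ℂ) ^ 2 ≠ 0 := fun j => by simpa using hp0 j
  have hqn : ∀ k, (‖q k‖ : ℂ) ^ 2 ≠ 0 := fun k => by simpa using hq0 k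
  have hsp : ∀ k, ∑ j, ‖p j‖ ^ 2 / (a j - b k) = 1 := by
    intro k
    have h : inner ℂ x (q k) = (‖q k‖ : ℂ) ^ 2 := by
      rw [← inner_conj_symm, hqx]
      simp
    rw [hxp, sum_inner] at h
    simp only [key] at h
    apply Complex.ofReal_injective
    push_cast
    apply mul_left_cancel₀ (hqn k)
    rw [Finset.mul_sum, mul_one]
    exact (Finset.sum_congr rfl fun j _ => by ring).trans h
  have hsq : ∀ j, ∑ k, ‖q k‖ ^ 2 / (-b k - -a j) = 1 := by
    intro j
    have h := hpx j
    rw [hxq, inner_sum] at h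
    simp only [key] at h
    apply Complex.ofReal_injective
    push_cast
    apply mul_left_cancel₀ (hpn j)
    rw [Finset.mul_sum, mul_one]
    exact (Finset.sum_congr rfl fun k _ => by rw [neg_sub_neg]; ring).trans h
  refine ⟨eq_prod_div_prod_of_sum_div_eq_one ha hb hab hsp, fun k => ?_⟩
  have h := eq_prod_div_prod_of_sum_div_eq_one (x := fun k => -b k) (y := fun j => -a j)
    (neg_injective.comp hb) (neg_injective.comp ha)
    (fun k j h => hab j k (neg_injective h).symm) hsq k
  simpa only [neg_sub_neg] using h


theorem strictAnti_fin_of_succ_lt {N : ℕ} {f : Fin N → ℝ}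
    (hf : ∀ (i : Fin N) (hi : (i : ℕ) + 1 < N), f ⟨(i : ℕ) + 1, hi⟩ < f i) : StrictAnti f := by
  cases N with
  | zero => exact fun i => i.elim0
  | succ n => exact Fin.strictAnti_iff_succ_lt.mpr fun i => hf i.castSucc (by simp)

/-- Explicit formulas for the norms of the spectral projections of `u`:
if `Σ_H(u) = {ρ_1 > σ_1 > ρ_2 > ⋯ > ρ_N > σ_N ≥ 0} ⊇ Σ_K(u)` interlaced, then
`‖u_j‖² = ∏_ℓ (ρ_j² − σ_ℓ²) / ∏_{ℓ≠j} (ρ_j² − ρ_ℓ²)` and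
`‖u'_k‖² = ∏_ℓ (ρ_ℓ² − σ_k²) / ∏_{ℓ≠k} (σ_ℓ² − σ_k²)`. -/
theorem norms_of_spectral_projections (N : ℕ) (hN : 1 ≤ N) (u : ℕ → ℂ)
    (hu : MemHs (1/2) u) (hfin : huRank u < Cardinal.aleph0)
    (ρ σ : Fin N → ℝ)
    (hSH : SigmaH u = Set.range ρ) (hSK : SigmaK u = Set.range σ)
    (h1 : ∀ i, σ i < ρ i)
    (h2 : ∀ i : Fin N, ∀ hi : (i : ℕ) + 1 < N, ρ ⟨(i : ℕ) + 1, hi⟩ < σ i)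
    (h3 : ∀ i, 0 ≤ σ i)
    (p q : Fin N → ℕ → ℂ)
    (hp : ∀ j, IsOrthProj (Espace u (ρ j)) u (p j))
    (hq : ∀ k, IsOrthProj (Fspace u (σ k)) u (q k)) :
    (∀ j, l2normSq (p j) =
        (∏ ℓ, (ρ j ^ 2 - σ ℓ ^ 2)) / ∏ ℓ ∈ Finset.univ.erase j, (ρ j ^ 2 - ρ ℓ ^ 2)) ∧
    (∀ k, l2normSq (q k) =
        (∏ ℓ, (ρ ℓ ^ 2 - σ k ^ 2)) / ∏ ℓ ∈ Finset.univ.erase k, (σ ℓ ^ 2 - σ k ^ 2)) := by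
  have hs := hu.summable_succ_mul
  obtain ⟨x, hxu⟩ : ∃ x : Hardy, (x : ℕ → ℂ) = u :=
    ⟨hankelRow hs 0, funext fun n => congrArg u (zero_add n)⟩
  have hxrow : hankelRow hs 0 = x :=
    Subtype.ext ((funext fun n => congrArg u (zero_add n)).trans hxu.symm)
  have hinner_eq : ∀ f g : Hardy, hinner f g = inner ℂ g f := fun f g => by
    rw [lp.inner_eq_tsum]
    rfl
  have hE : ∀ (τ : ℝ) (v : Hardy),
      (v : ℕ → ℂ) ∈ Espace u τ ↔ hankelSq hs v = ((τ ^ 2 : ℝ) : ℂ) • v := by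
    intro τ v
    rw [Subtype.ext_iff]
    push_cast
    exact ⟨fun h => h.2, fun h => ⟨lp.memℓp v, h⟩⟩
  have hF : ∀ (τ : ℝ) (v : Hardy), (v : ℕ → ℂ) ∈ Fspace u τ ↔
      hankelSq (summable_succ_mul_shift hs) v = ((τ ^ 2 : ℝ) : ℂ) • v := by
    intro τ v
    rw [Subtype.ext_iff]
    push_cast
    refine ⟨fun h => ?_, fun h => ⟨lp.memℓp v, ?_⟩⟩
    · exact (ku2_eq_hu2_shift u v).symm.trans h.2
    · exact (ku2_eq_hu2_shift u v).trans h
  have hproj : ∀ {V : Set (ℕ → ℂ)} {T : Hardy →ₗ[ℂ] Hardy} {c : ℂ} {f : ℕ → ℂ},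
      (∀ g ∈ V, MemL2 g) → (∀ v : Hardy, (v : ℕ → ℂ) ∈ V ↔ T v = c • v) → IsOrthProj V u f →
      (∃ v ∈ V, hinner u v ≠ 0) → ∃ P : Hardy, (P : ℕ → ℂ) = f ∧ T P = c • P ∧
        (∀ v, T v = c • v → inner ℂ v (x - P) = 0) ∧ P ≠ 0 ∧ inner ℂ P x = (‖P‖ : ℂ) ^ 2 := by
    rintro V T c f hVmem hV ⟨hfV, hf⟩ ⟨v, hvV, hv⟩
    let P : Hardy := ⟨f, hVmem f hfV⟩
    have hP : ∀ v, T v = c • v → inner ℂ v (x - P) = 0 := fun v hv => by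
      rw [← hinner_eq, lp.coeFn_sub, hxu]
      exact hf v ((hV v).mpr hv)
    have hTP : T P = c • P := (hV P).mp hfV
    refine ⟨P, rfl, hTP, hP, fun h0 => hv ?_, ?_⟩
    · have h := hP ⟨v, hVmem v hvV⟩ ((hV _).mp hvV)
      rw [h0, sub_zero, ← hinner_eq, hxu] at h
      exact h
    · have h := hP P hTP
      rw [inner_sub_right, sub_eq_zero] at h
      rw [h, inner_self_eq_norm_sq_to_K]
      rfl
  have hρ : ∀ j, 0 < ρ j ∧ ∃ v ∈ Espace u (ρ j), hinner u v ≠ 0 := fun j =>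
    hSH.symm.subset (Set.mem_range_self j)
  have hσ : ∀ k, 0 ≤ σ k ∧ ∃ v ∈ Fspace u (σ k), hinner u v ≠ 0 := fun k =>
    hSK.symm.subset (Set.mem_range_self k)
  choose P hPp hP hPproj hP0 hPx using fun j =>
    hproj (fun _ h => h.1) (hE (ρ j)) (hp j) (hρ j).2
  choose Q hQq hQ hQproj hQ0 hQx using fun k =>
    hproj (fun _ h => h.1) (hF (σ k)) (hq k) (hσ k).2
  have hσanti : StrictAnti σ := strictAnti_fin_of_succ_lt fun i hi => (h1 _).trans (h2 i hi)
  have hρanti : StrictAnti ρ := strictAnti_fin_of_succ_lt fun i hi => (h2 i hi).trans (h1 i)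
  have hρσ : ∀ j k, ρ j ≠ σ k := by
    intro j k
    rcases le_or_gt j k with hjk | hjk
    · exact ((hσanti.antitone hjk).trans_lt (h1 j)).ne'
    · have hk : (k : ℕ) + 1 < N := lt_of_le_of_lt hjk j.2
      exact ((hρanti.antitone (show (⟨k + 1, hk⟩ : Fin N) ≤ j from hjk)).trans_lt (h2 k hk)).ne
  have hsq : ∀ {s t : ℝ}, 0 ≤ s → 0 ≤ t → s ^ 2 = t ^ 2 → s = t := fun hs ht h =>
    (pow_left_inj₀ hs ht two_ne_zero).mp h
  have ha : Function.Injective fun j => ρ j ^ 2 := fun i j h =>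
    hρanti.injective (hsq (hρ i).1.le (hρ j).1.le h)
  have hb : Function.Injective fun k => σ k ^ 2 := fun i j h =>
    hσanti.injective (hsq (h3 i) (h3 j) h)
  have := finiteDimensional_range_hankelSq hs hfin
  have := finiteDimensional_range_hankelSq_shift hs hfin
  have hxP : x = ∑ j, P j := by
    refine (hankelSq_isPositive hs).1.eq_sum_of_orthogonal_projections ha hP hPproj ?_
    intro μ v hv hμ
    by_cases hv0 : v = 0
    · rw [hv0, inner_zero_left]
    obtain ⟨τ, hτ, rfl⟩ := (hankelSq_isPositive hs).exists_eq_sq_of_eigenvector hv hv0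
    rcases hτ.eq_or_lt with rfl | hτ
    · rw [← hxrow]
      exact inner_hankelRow_zero_eq_zero hs (by simpa using hv)
    · by_contra hne
      have hmem : τ ∈ SigmaH u := ⟨hτ, v, (hE τ v).mpr (by exact_mod_cast hv), by
        rwa [← hxu, hinner_eq]⟩
      obtain ⟨j, rfl⟩ := hSH.subset hmem
      exact hμ j (by push_cast; rfl)
  have hxQ : x = ∑ k, Q k := by
    have hpos := hankelSq_isPositive (summable_succ_mul_shift hs)
    refine hpos.1.eq_sum_of_orthogonal_projections hb hQ hQproj ?_
    intro μ v hv hμ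
    by_cases hv0 : v = 0
    · rw [hv0, inner_zero_left]
    obtain ⟨τ, hτ, rfl⟩ := hpos.exists_eq_sq_of_eigenvector hv hv0
    by_contra hne
    have hmem : τ ∈ SigmaK u := ⟨hτ, v, (hF τ v).mpr (by exact_mod_cast hv), by
      rwa [← hxu, hinner_eq]⟩
    obtain ⟨k, rfl⟩ := hSK.subset hmem
    exact hμ k (by push_cast; rfl)
  have hmain := norm_sq_of_rank_one_perturbation (hankelSq_isPositive hs).1
    (fun h => hxrow ▸ hankelSq_shift hs h) ha hb
    (fun j k h => hρσ j k (hsq (hρ j).1.le (h3 k) h)) hP hQ hP0 hQ0 hPx hQx hxP hxQ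
  refine ⟨fun j => ?_, fun k => ?_⟩
  · rw [← hmain.1 j, norm_sq_eq_tsum, hPp]
    rfl
  · rw [← hmain.2 k, norm_sq_eq_tsum, hQq]
    rfl

end
end
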